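/- Let Ω ∈ K^{n×ℓ} be a random embedding that has full column rank almost surely and satisfies UΩ ~ Ω for each unitary U ∈ K^{n×n}. Then for any positive-semidefinite matrix H ∈ K^{n×n} with r := rank(H) ≥ ℓ, E tr(H − H⟨Ω⟩) ≤ min over natural numbers q with q < ℓ − α_K of ((r − ℓ)/(r − q)) · (1 + q/(ℓ − q − α_K)) · tr(H − [H]_q). -/

import Mathlib

open MeasureTheory ProbabilityTheory Matrix Filter
open scoped ENNReal Topology ComplexOrder

noncomputable section

open Classical in
/-- `α_K`: 1 if `K = ℝ`, 0 if `K = ℂ`. -/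
def alphaK (K : Type*) [RCLike K] : ℝ := if (RCLike.I : K) = 0 then 1 else 0

/-- Squared Frobenius norm of a matrix. -/
def frobSq {K : Type*} [RCLike K] {m n : Type*} [Fintype m] [Fintype n]
    (A : Matrix m n K) : ℝ := ∑ i, ∑ j, ‖A i j‖ ^ 2

/-- The four Penrose conditions characterizing the Moore–Penrose pseudoinverse. -/
def IsMoorePenrose {K : Type*} [RCLike K] {m n : Type*} [Fintype m] [Fintype n]
    (A : Matrix m n K) (X : Matrix n m K) : Prop :=
  A * X * A = A ∧ X * A * X = X ∧ (A * X)ᴴ = A * X ∧ (X * A)ᴴ = X * A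

instance matrixMeasurableSpace {m n α : Type*} [MeasurableSpace α] :
    MeasurableSpace (Matrix m n α) :=
  inferInstanceAs (MeasurableSpace (m → n → α))

/-- `M` is rotation-invariant: `U * M` has the same distribution as `M` for every unitary `U`. -/
def RotationInvariant {K : Type*} [RCLike K] [MeasurableSpace K]
    {Y : Type*} [MeasurableSpace Y] (μ : Measure Y) {n ℓ : ℕ}
    (M : Y → Matrix (Fin n) (Fin ℓ) K) : Prop :=
  ∀ U : Matrix (Fin n) (Fin n) K, U ∈ Matrix.unitaryGroup (Fin n) K →
    Measure.map (fun ω => U * M ω) μ = Measure.map M μ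

/-- `M` is a random orthonormal embedding: rotation-invariant, with orthonormal
columns almost surely. -/
def IsRandomOrthonormal {K : Type*} [RCLike K] [MeasurableSpace K]
    {Y : Type*} [MeasurableSpace Y] (μ : Measure Y) {n ℓ : ℕ}
    (M : Y → Matrix (Fin n) (Fin ℓ) K) : Prop :=
  Measurable M ∧ RotationInvariant μ M ∧ ∀ᵐ ω ∂μ, (M ω)ᴴ * M ω = 1

/-- `Aq` is a best rank-`q` approximation of `A` in Frobenius norm
(equivalently, a matrix obtained from a `q`-truncated SVD of `A`). -/
def IsBestRankApprox {K : Type*} [RCLike K] {m n : Type*} [Fintype m] [Fintype n]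
    [DecidableEq n] (q : ℕ) (A Aq : Matrix m n K) : Prop :=
  Aq.rank ≤ q ∧ ∀ B : Matrix m n K, B.rank ≤ q → frobSq (A - Aq) ≤ frobSq (A - B)

section aux
variable {K : Type*} [RCLike K]

def givens {n : ℕ} (i j : Fin n) (c s : ℝ) : Matrix (Fin n) (Fin n) K :=
  Matrix.of fun a b =>
    if a = i then (if b = i then (c : K) else if b = j then (s : K) else 0)
    else if a = j then (if b = i then -(s : K) else if b = j then (c : K) else 0)
    else if a = b then 1 else 0

lemma givens_mul {n : ℕ} {m : Type*} (i j : Fin n) (hij : i ≠ j) (c s : ℝ)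
    (X : Matrix (Fin n) m K) (a : Fin n) (b : m) :
    ((givens i j c s : Matrix (Fin n) (Fin n) K) * X) a b =
      if a = i then (c : K) * X i b + (s : K) * X j b
      else if a = j then -(s : K) * X i b + (c : K) * X j b else X a b := by
  rw [Matrix.mul_apply]
  by_cases h1 : a = i
  · have : ∀ x, (givens i j c s : Matrix _ _ K) a x * X x b =
        (if x = i then (c : K) * X i b else 0) + (if x = j then (s : K) * X j b else 0) := by
      intro x
      by_cases hx : x = i
      · subst hx; simp [givens, h1, hij]
      · by_cases hy : x = j
        · subst hy; simp [givens, h1, hx]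
        · simp [givens, h1, hx, hy]
    simp only [this, Finset.sum_add_distrib]
    simp [h1]
  · by_cases h2 : a = j
    · have : ∀ x, (givens i j c s : Matrix _ _ K) a x * X x b =
        (if x = i then -(s : K) * X i b else 0) + (if x = j then (c : K) * X j b else 0) := by
        intro x
        by_cases hx : x = i
        · subst hx; simp [givens, h2, hij, hij.symm]
        · by_cases hy : x = j
          · subst hy; simp [givens, h2, hx]
          · simp [givens, h2, hx, hy]
      simp only [this, Finset.sum_add_distrib]
      simp [h2, hij.symm]
    · simp [givens, h1, h2]

lemma givens_conjTranspose {n : ℕ} (i j : Fin n) (hij : i ≠ j) (c s : ℝ) :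
    (givens i j c s : Matrix _ _ K)ᴴ = givens i j c (-s) := by
  ext a b
  simp only [givens, Matrix.conjTranspose_apply, Matrix.of_apply]
  have := hij.symm
  by_cases h1 : a = i <;> by_cases h2 : a = j <;> by_cases h3 : b = i <;> by_cases h4 : b = j <;>
    by_cases h5 : a = b <;> simp_all [eq_comm]

lemma givens_mul_self {n : ℕ} (i j : Fin n) (hij : i ≠ j) (c s : ℝ) (h : c ^ 2 + s ^ 2 = 1) :
    (givens i j c s : Matrix _ _ K) * givens i j c (-s) = 1 := by
  have hK : (c : K) ^ 2 + (s : K) ^ 2 = 1 := by exact_mod_cast congrArg (fun x : ℝ => (x : K)) h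
  have := hij.symm
  ext a b
  rw [givens_mul i j hij]
  by_cases h1 : a = i
  · by_cases h3 : b = i
    · simp_all [givens, Matrix.one_apply]; linear_combination hK
    · by_cases h4 : b = j <;> simp_all [givens, Matrix.one_apply, eq_comm]; ring
  · by_cases h2 : a = j
    · by_cases h3 : b = i
      · simp_all [givens, Matrix.one_apply]; ring
      · by_cases h4 : b = j <;> simp_all [givens, Matrix.one_apply, eq_comm]; ring
    · simp_all [givens, Matrix.one_apply, eq_comm]

lemma givens_unitary {n : ℕ} (i j : Fin n) (hij : i ≠ j) (c s : ℝ) (h : c ^ 2 + s ^ 2 = 1) :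
    (givens i j c s : Matrix _ _ K) ∈ Matrix.unitaryGroup (Fin n) K := by
  rw [Matrix.mem_unitaryGroup_iff, Matrix.star_eq_conjTranspose, givens_conjTranspose i j hij]
  exact givens_mul_self i j hij c s h

/-- Xᴴ D X is singular iff some nonzero coefficient vector is killed on the support. -/
lemma quad_det_eq_zero_iff {n ℓ : ℕ} (lam : Fin n → ℝ) (hl : ∀ i, 0 ≤ lam i)
    (X : Matrix (Fin n) (Fin ℓ) K) :
    (Xᴴ * Matrix.diagonal (fun i => (lam i : K)) * X).det = 0 ↔
      ∃ c : Fin ℓ → K, c ≠ 0 ∧ ∀ a, lam a ≠ 0 → (X *ᵥ c) a = 0 := by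
  rw [← Matrix.exists_mulVec_eq_zero_iff]
  refine exists_congr fun c => and_congr_right fun _ => ?_
  constructor
  · intro h a ha
    have h1 : star c ⬝ᵥ ((Xᴴ * Matrix.diagonal (fun i => (lam i : K)) * X) *ᵥ c) = 0 := by
      rw [h]; simp
    have h2 : star c ⬝ᵥ ((Xᴴ * Matrix.diagonal (fun i => (lam i : K)) * X) *ᵥ c)
        = ((∑ a, lam a * ‖(X *ᵥ c) a‖ ^ 2 : ℝ) : K) := by
      rw [Matrix.mul_assoc, ← Matrix.mulVec_mulVec, Matrix.dotProduct_mulVec, ← Matrix.star_mulVec,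
        ← Matrix.mulVec_mulVec]
      simp only [dotProduct, Matrix.mulVec_diagonal, Pi.star_apply, RCLike.star_def]
      push_cast
      refine Finset.sum_congr rfl fun a _ => ?_
      rw [← RCLike.conj_mul]; ring
    rw [h2] at h1
    have h3 : (∑ a, lam a * ‖(X *ᵥ c) a‖ ^ 2 : ℝ) = 0 := by exact_mod_cast h1
    rw [Finset.sum_eq_zero_iff_of_nonneg (fun a _ => mul_nonneg (hl a) (by positivity))] at h3
    have := h3 a (Finset.mem_univ _)
    simpa [ha] using this
  · intro h
    rw [Matrix.mul_assoc, ← Matrix.mulVec_mulVec, ← Matrix.mulVec_mulVec]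
    have : (Matrix.diagonal (fun i => (lam i : K))) *ᵥ (X *ᵥ c) = 0 := by
      ext a
      rw [Matrix.mulVec_diagonal]
      by_cases ha : lam a = 0
      · simp [ha]
      · simp [h a ha]
    rw [this]; simp

lemma ae_imp_of_seq {α : Type*} [MeasurableSpace α] (ν : Measure α) [IsProbabilityMeasure ν]
    (A : ℕ → Set α) (hA : ∀ m, MeasurableSet (A m)) (hm : ∀ m, ν (A m) = ν (A 0))
    (hint : ∀ᵐ x ∂ν, ∀ m m', m ≠ m' → x ∈ A m → x ∈ A m' → ∀ k, x ∈ A k) :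
    ∀ᵐ x ∂ν, x ∈ A 0 → x ∈ A 1 := by
  set B := A 0 ∩ A 1 with hB
  have hBm : MeasurableSet B := (hA 0).inter (hA 1)
  have hBA : ∀ m, ν (A m \ B) = ν (A 0) - ν B := by
    intro m
    have h1 : ν (A m \ B) = ν (A m \ (B ∩ A m)) := by simp
    have h2 : (B ∩ A m : Set α) =ᵐ[ν] B := by
      filter_upwards [hint] with x hx
      apply propext
      exact ⟨fun h => h.1, fun h => ⟨h, hx 0 1 (by norm_num) h.1 h.2 m⟩⟩
    rw [h1, measure_sdiff Set.inter_subset_right (hBm.inter (hA m)).nullMeasurableSet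
      (measure_ne_top _ _), hm, measure_congr h2]
  have hdis : Pairwise (Function.onFun (AEDisjoint ν) (fun m => A m \ B)) := by
    intro m m' hmm
    change ν _ = 0
    rw [measure_eq_zero_iff_ae_notMem]
    filter_upwards [hint] with x hx h
    exact h.1.2 ⟨hx m m' hmm h.1.1 h.2.1 0, hx m m' hmm h.1.1 h.2.1 1⟩
  have hsum := measure_iUnion₀ hdis (fun m => ((hA m).diff hBm).nullMeasurableSet)
  have hz : ν (A 0 \ B) = 0 := by
    by_contra hne
    simp only [hBA] at hsum hne
    rw [ENNReal.tsum_const_eq_top_of_ne_zero hne] at hsum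
    exact measure_ne_top _ _ hsum
  rw [measure_eq_zero_iff_ae_notMem] at hz
  filter_upwards [hz] with x hx h0
  by_contra h1
  exact hx ⟨h0, fun h => h1 h.2⟩

end aux

section aux2
variable {K : Type*} [RCLike K] [MeasurableSpace K] [BorelSpace K]

instance matBorel {n ℓ : ℕ} : BorelSpace (Matrix (Fin n) (Fin ℓ) K) :=
  inferInstanceAs (BorelSpace (Fin n → Fin ℓ → K))

/-- a nonzero combination of columns vanishing off `T` -/
def Bad {n ℓ : ℕ} (T : Finset (Fin n)) (X : Matrix (Fin n) (Fin ℓ) K) : Prop :=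
  ∃ c : Fin ℓ → K, c ≠ 0 ∧ ∀ a, a ∉ T → (X *ᵥ c) a = 0

lemma bad_iff {n ℓ : ℕ} (T : Finset (Fin n)) (X : Matrix (Fin n) (Fin ℓ) K) :
    Bad T X ↔ (Xᴴ * Matrix.diagonal (fun i => ((if i ∈ T then 0 else 1 : ℝ) : K)) * X).det = 0 := by
  rw [quad_det_eq_zero_iff _ (fun i => by split_ifs <;> norm_num)]
  simp [Bad]

lemma measurable_bad {n ℓ : ℕ} (T : Finset (Fin n)) :
    MeasurableSet {X : Matrix (Fin n) (Fin ℓ) K | Bad T X} := by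
  simp only [bad_iff]
  have : Continuous fun X : Matrix (Fin n) (Fin ℓ) K =>
      (Xᴴ * Matrix.diagonal (fun i => ((if i ∈ T then 0 else 1 : ℝ) : K)) * X).det := by
    fun_prop
  exact this.measurable (measurableSet_singleton 0)

/-- structure of rotated bad events -/
lemma bad_givens {n ℓ : ℕ} (T : Finset (Fin n)) (j k : Fin n) (hjk : j ≠ k) (hk : k ∉ T)
    (m : ℕ) (X : Matrix (Fin n) (Fin ℓ) K) :
    Bad (insert j T) ((givens j k (1 / √(1 + (m : ℝ) ^ 2)) (m / √(1 + (m : ℝ) ^ 2)) :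
      Matrix (Fin n) (Fin n) K) * X) ↔
      ∃ c : Fin ℓ → K, c ≠ 0 ∧ (∀ a, a ∉ T → a ≠ j → a ≠ k → (X *ᵥ c) a = 0) ∧
        (X *ᵥ c) k = m * (X *ᵥ c) j := by
  have hpos : (0 : ℝ) < √(1 + (m : ℝ) ^ 2) := by positivity
  have hposK : ((√(1 + (m : ℝ) ^ 2) : ℝ) : K) ≠ 0 := by exact_mod_cast hpos.ne'
  refine exists_congr fun c => and_congr_right fun _ => ?_
  have hG : ∀ a, (((givens j k (1 / √(1 + (m : ℝ) ^ 2)) (m / √(1 + (m : ℝ) ^ 2)) :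
      Matrix (Fin n) (Fin n) K) * X) *ᵥ c) a =
      if a = j then ((1 / √(1 + (m : ℝ) ^ 2) : ℝ) : K) * (X *ᵥ c) j
          + ((m / √(1 + (m : ℝ) ^ 2) : ℝ) : K) * (X *ᵥ c) k
      else if a = k then -((m / √(1 + (m : ℝ) ^ 2) : ℝ) : K) * (X *ᵥ c) j
          + ((1 / √(1 + (m : ℝ) ^ 2) : ℝ) : K) * (X *ᵥ c) k else (X *ᵥ c) a := by
    intro a
    have h := givens_mul j k hjk (1 / √(1 + (m : ℝ) ^ 2)) (m / √(1 + (m : ℝ) ^ 2))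
      (X * Matrix.of (fun (b : Fin ℓ) (_ : Unit) => c b)) a ()
    rw [← Matrix.mul_assoc] at h
    simpa [Matrix.mul_apply, Matrix.mulVec, dotProduct] using h
  simp only [hG]
  constructor
  · intro h
    refine ⟨fun a ha haj hak => ?_, ?_⟩
    · have := h a (by simp [ha, haj])
      simpa [haj, hak] using this
    · have := h k (by simp [hk, hjk.symm])
      simp [hjk.symm] at this
      field_simp at this
      linear_combination this
  · rintro ⟨h1, h2⟩ a ha
    simp only [Finset.mem_insert, not_or] at ha
    rw [if_neg ha.1]
    by_cases hak : a = k
    · rw [if_pos hak, h2]; push_cast; field_simp; ring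
    · rw [if_neg hak]; exact h1 a ha.2 ha.1 hak

lemma ae_not_bad {n ℓ : ℕ} (ν : Measure (Matrix (Fin n) (Fin ℓ) K)) [IsProbabilityMeasure ν]
    (hinv : ∀ U ∈ Matrix.unitaryGroup (Fin n) K, MeasurePreserving (fun X => U * X) ν ν)
    (hfull : ∀ᵐ X ∂ν, X.rank = ℓ) (T : Finset (Fin n)) :
    T.card + ℓ ≤ n → ∀ᵐ X ∂ν, ¬ Bad T X := by
  induction T using Finset.induction_on with
  | empty =>
    intro _
    filter_upwards [hfull] with X hX ⟨c, hc, h⟩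
    have hli : LinearIndependent K X.col := by
      rw [linearIndependent_iff_card_eq_finrank_span, Set.finrank, ← Matrix.rank_eq_finrank_span_cols, hX]
      simp
    have hinj := Matrix.mulVec_injective_iff.2 hli
    exact hc (hinj (by ext a; simpa using h a (by simp)))
  | insert j T hj ih =>
    intro hcard
    rw [Finset.card_insert_of_notMem hj] at hcard
    have ihT := ih (by omega)
    have key : ∀ k, k ∉ insert j T → ∀ᵐ X ∂ν, Bad (insert j T) X →
        ∃ c : Fin ℓ → K, (∀ a, a ∉ T → a ≠ k → (X *ᵥ c) a = 0) ∧ (X *ᵥ c) k ≠ 0 := by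
      intro k hk
      simp only [Finset.mem_insert, not_or] at hk
      have hjk : j ≠ k := fun h => hk.1 h.symm
      let U : ℕ → Matrix (Fin n) (Fin n) K := fun m =>
        givens j k (1 / √(1 + (m : ℝ) ^ 2)) (m / √(1 + (m : ℝ) ^ 2))
      have hU : ∀ m, U m ∈ Matrix.unitaryGroup (Fin n) K := fun m =>
        givens_unitary j k hjk _ _ (by
          rw [div_pow, div_pow, Real.sq_sqrt (by positivity)]; field_simp)
      let A : ℕ → Set (Matrix (Fin n) (Fin ℓ) K) := fun m => {X | Bad (insert j T) (U m * X)}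
      have hAmeas : ∀ m, MeasurableSet (A m) := fun m =>
        (hinv _ (hU m)).measurable (measurable_bad _)
      have hAm : ∀ m, ν (A m) = ν {X | Bad (insert j T) X} := fun m =>
        (hinv _ (hU m)).measure_preimage (measurable_bad _).nullMeasurableSet
      have hA' : ∀ m X, X ∈ A m ↔ ∃ c : Fin ℓ → K, c ≠ 0 ∧
          (∀ a, a ∉ T → a ≠ j → a ≠ k → (X *ᵥ c) a = 0) ∧ (X *ᵥ c) k = m * (X *ᵥ c) j :=
        fun m X => bad_givens T j k hjk hk.2 m X
      have hnorm : ∀ᵐ X ∂ν, ∀ m, X ∈ A m → ∃ c : Fin ℓ → K,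
          (∀ a, a ∉ T → a ≠ j → a ≠ k → (X *ᵥ c) a = 0) ∧ (X *ᵥ c) j = 1 ∧ (X *ᵥ c) k = m := by
        filter_upwards [ihT] with X hX m hm
        obtain ⟨c, hc, h1, h2⟩ := (hA' m X).1 hm
        have hne : (X *ᵥ c) j ≠ 0 := by
          intro h0
          refine hX ⟨c, hc, fun a ha => ?_⟩
          by_cases haj : a = j
          · rw [haj, h0]
          by_cases hak : a = k
          · rw [hak, h2, h0, mul_zero]
          exact h1 a ha haj hak
        refine ⟨((X *ᵥ c) j)⁻¹ • c, fun a ha haj hak => ?_, ?_, ?_⟩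
        · rw [Matrix.mulVec_smul, Pi.smul_apply, h1 a ha haj hak, smul_zero]
        · rw [Matrix.mulVec_smul, Pi.smul_apply, smul_eq_mul, inv_mul_cancel₀ hne]
        · rw [Matrix.mulVec_smul, Pi.smul_apply, smul_eq_mul, h2]; field_simp
      have hint : ∀ᵐ X ∂ν, ∀ m m', m ≠ m' → X ∈ A m → X ∈ A m' → ∀ k, X ∈ A k := by
        filter_upwards [hnorm] with X hX m m' hmm hm hm' p
        obtain ⟨c, h1, h2, h3⟩ := hX m hm
        obtain ⟨c', h1', h2', h3'⟩ := hX m' hm'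
        have hd : (m : K) - m' ≠ 0 := sub_ne_zero.2 (by exact_mod_cast hmm)
        rw [hA']
        have e1 : ∀ a, (X *ᵥ ((((p : K) - m') / (m - m')) • c + (((m : K) - p) / (m - m')) • c')) a
            = (((p : K) - m') / (m - m')) * (X *ᵥ c) a + ((m - p) / (m - m')) * (X *ᵥ c') a := by
          intro a
          rw [Matrix.mulVec_add, Matrix.mulVec_smul, Matrix.mulVec_smul]; rfl
        have e2 : (X *ᵥ ((((p : K) - m') / (m - m')) • c + (((m : K) - p) / (m - m')) • c')) j = 1 := by
          rw [e1, h2, h2']; field_simp; ring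
        refine ⟨(((p : K) - m') / (m - m')) • c + (((m : K) - p) / (m - m')) • c', ?_, ?_, ?_⟩
        · intro h0; rw [h0] at e2; simp at e2
        · intro a ha haj hak; rw [e1, h1 a ha haj hak, h1' a ha haj hak]; simp
        · rw [e2, e1, h3, h3']; field_simp; ring
      have h01 := ae_imp_of_seq ν A hAmeas (fun m => by rw [hAm, hAm]) hint
      filter_upwards [h01, hnorm] with X hX hN hbad
      have hX0 : X ∈ A 0 := by
        rw [hA']
        obtain ⟨c, hc, h⟩ := hbad
        exact ⟨c, hc, fun a ha haj _ => h a (by simp [ha, haj]), by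
          simpa using h k (by simp [hk])⟩
      obtain ⟨c, h1, h2, h3⟩ := hN 0 hX0
      obtain ⟨c', h1', h2', h3'⟩ := hN 1 (hX hX0)
      refine ⟨c' - c, fun a ha hak => ?_, ?_⟩
      · rw [Matrix.mulVec_sub, Pi.sub_apply]
        by_cases haj : a = j
        · rw [haj, h2, h2', sub_self]
        · rw [h1 a ha haj hak, h1' a ha haj hak, sub_self]
      · rw [Matrix.mulVec_sub, Pi.sub_apply, h3, h3']; simp
    have key' : ∀ᵐ X ∂ν, ∀ k, k ∉ insert j T → Bad (insert j T) X →
        ∃ c : Fin ℓ → K, (∀ a, a ∉ T → a ≠ k → (X *ᵥ c) a = 0) ∧ (X *ᵥ c) k ≠ 0 := by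
      rw [ae_all_iff]
      intro k
      by_cases hk : k ∈ insert j T
      · simp [hk]
      · filter_upwards [key k hk] with X hX _ using hX
    filter_upwards [key', ihT] with X hX hT hbad
    have hall : ∀ k : {k // k ∉ T}, ∃ c : Fin ℓ → K,
        (∀ a, a ∉ T → a ≠ k → (X *ᵥ c) a = 0) ∧ (X *ᵥ c) k ≠ 0 := by
      rintro ⟨k, hk⟩
      by_cases hkj : k = j
      · subst hkj
        obtain ⟨c, hc, h⟩ := hbad
        refine ⟨c, fun a ha hak => h a (by simp [ha, hak]), fun h0 => hT ⟨c, hc, fun a ha => ?_⟩⟩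
        by_cases hak : a = k
        · rw [hak]; exact h0
        · exact h a (by simp [ha, hak])
      · exact hX k (by simp [hk, hkj]) hbad
    choose f hf1 hf2 using hall
    have hli : LinearIndependent K f := by
      rw [Fintype.linearIndependent_iff]
      intro g hg k
      have h1 : (X *ᵥ (∑ i, g i • f i)) k = 0 := by rw [hg]; simp
      rw [Matrix.mulVec_sum, Finset.sum_apply, Finset.sum_eq_single k] at h1
      · rw [Matrix.mulVec_smul, Pi.smul_apply, smul_eq_mul] at h1
        exact (mul_eq_zero.1 h1).resolve_right (hf2 k)
      · intro b _ hb
        rw [Matrix.mulVec_smul, Pi.smul_apply, hf1 b k k.2 (fun h => hb (Subtype.ext h.symm)),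
          smul_zero]
      · simp
    have hc := hli.fintype_card_le_finrank
    rw [Module.finrank_fin_fun, Fintype.card_subtype_compl] at hc
    simp at hc
    omega
end aux2

section aux3
variable {K : Type*} [RCLike K]

/-- The Nyström core matrix. -/
def Nf {n ℓ : ℕ} (A : Matrix (Fin n) (Fin n) K) (X : Matrix (Fin n) (Fin ℓ) K) :
    Matrix (Fin n) (Fin n) K := X * (Xᴴ * A * X)⁻¹ * Xᴴ

abbrev Dg {n : ℕ} (lam : Fin n → ℝ) : Matrix (Fin n) (Fin n) K :=
  Matrix.diagonal (fun i => (lam i : K))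

lemma Dg_herm {n : ℕ} (lam : Fin n → ℝ) : (Dg lam : Matrix _ _ K)ᴴ = Dg lam := by
  simp [Dg, Matrix.diagonal_conjTranspose, Pi.star_def]

lemma Nf_herm {n ℓ : ℕ} (A : Matrix (Fin n) (Fin n) K) (hA : Aᴴ = A)
    (X : Matrix (Fin n) (Fin ℓ) K) : (Nf A X)ᴴ = Nf A X := by
  simp only [Nf, Matrix.conjTranspose_mul, Matrix.conjTranspose_nonsing_inv,
    Matrix.conjTranspose_conjTranspose, hA, Matrix.mul_assoc]

lemma Nf_resolvent {n ℓ : ℕ} (A A' : Matrix (Fin n) (Fin n) K) (X : Matrix (Fin n) (Fin ℓ) K)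
    (h : (Xᴴ * A * X).det ≠ 0) (h' : (Xᴴ * A' * X).det ≠ 0) :
    Nf A X - Nf A' X = Nf A X * A' * Nf A' X - Nf A X * A * Nf A' X := by
  have e : (Xᴴ * A * X)⁻¹ * (Xᴴ * A * X) = 1 := Matrix.nonsing_inv_mul _ h.isUnit
  have e' : (Xᴴ * A' * X) * (Xᴴ * A' * X)⁻¹ = 1 := Matrix.mul_nonsing_inv _ h'.isUnit
  have h1 : Nf A X * A' * Nf A' X = Nf A X := by
    calc Nf A X * A' * Nf A' X
        = X * (Xᴴ * A * X)⁻¹ * ((Xᴴ * A' * X) * (Xᴴ * A' * X)⁻¹) * Xᴴ := by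
          simp only [Nf, Matrix.mul_assoc]
      _ = _ := by rw [e', Matrix.mul_one]; rfl
  have h2 : Nf A X * A * Nf A' X = Nf A' X := by
    calc Nf A X * A * Nf A' X
        = X * ((Xᴴ * A * X)⁻¹ * (Xᴴ * A * X)) * (Xᴴ * A' * X)⁻¹ * Xᴴ := by
          simp only [Nf, Matrix.mul_assoc]
      _ = _ := by rw [e, Matrix.mul_one]; rfl
  rw [h1, h2]

lemma Nf_idem {n ℓ : ℕ} (A : Matrix (Fin n) (Fin n) K) (X : Matrix (Fin n) (Fin ℓ) K)
    (h : (Xᴴ * A * X).det ≠ 0) : Nf A X * A * Nf A X = Nf A X := by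
  have e : (Xᴴ * A * X)⁻¹ * (Xᴴ * A * X) = 1 := Matrix.nonsing_inv_mul _ h.isUnit
  calc Nf A X * A * Nf A X
        = X * ((Xᴴ * A * X)⁻¹ * (Xᴴ * A * X)) * (Xᴴ * A * X)⁻¹ * Xᴴ := by
          simp only [Nf, Matrix.mul_assoc]
      _ = _ := by rw [e, Matrix.mul_one]; rfl

lemma Nf_trace {n ℓ : ℕ} (A : Matrix (Fin n) (Fin n) K) (X : Matrix (Fin n) (Fin ℓ) K)
    (h : (Xᴴ * A * X).det ≠ 0) : (A * Nf A X).trace = ℓ := by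
  have e : (Xᴴ * A * X)⁻¹ * (Xᴴ * A * X) = 1 := Matrix.nonsing_inv_mul _ h.isUnit
  calc (A * Nf A X).trace = ((A * X) * ((Xᴴ * A * X)⁻¹ * Xᴴ)).trace := by
        simp only [Nf, Matrix.mul_assoc]
    _ = (((Xᴴ * A * X)⁻¹ * (Xᴴ * A * X))).trace := by
        rw [Matrix.trace_mul_comm]; simp only [Matrix.mul_assoc]
    _ = _ := by rw [e]; simp

lemma Nf_mul_left {n ℓ : ℕ} (A G : Matrix (Fin n) (Fin n) K) (X : Matrix (Fin n) (Fin ℓ) K) :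
    Nf A (G * X) = G * Nf (Gᴴ * A * G) X * Gᴴ := by
  simp only [Nf, Matrix.conjTranspose_mul, Matrix.mul_assoc]

section diag

lemma Nf_star
    {n ℓ : ℕ} (lam : Fin n → ℝ)
    (X : Matrix (Fin n) (Fin ℓ) K) (i j : Fin n) : (starRingEnd K) (Nf (Dg lam) X i j) = Nf (Dg lam) X j i := by
  have := congrFun (congrFun (Nf_herm (Dg lam) (Dg_herm lam) X) j) i
  simpa [Matrix.conjTranspose_apply] using this

lemma Nf_diag_real
    {n ℓ : ℕ} (lam : Fin n → ℝ)
    (X : Matrix (Fin n) (Fin ℓ) K) (i : Fin n) : ((RCLike.re (Nf (Dg lam) X i i) : ℝ) : K) = Nf (Dg lam) X i i :=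
  RCLike.conj_eq_iff_re.1 (Nf_star lam X i i)

lemma Nf_sum
    {n ℓ : ℕ} (lam : Fin n → ℝ)
    (X : Matrix (Fin n) (Fin ℓ) K) (h : (Xᴴ * (Dg lam : Matrix (Fin n) (Fin n) K) * X).det ≠ 0) (i : Fin n) :
    ∑ j, lam j * ‖Nf (Dg lam) X i j‖ ^ 2 = RCLike.re (Nf (Dg lam) X i i) := by
  have h1 := congrFun (congrFun (Nf_idem (Dg lam) X h) i) i
  have h2 : (((∑ j, lam j * ‖Nf (Dg lam) X i j‖ ^ 2 : ℝ)) : K) = Nf (Dg lam) X i i := by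
    rw [← h1, Matrix.mul_apply]
    push_cast
    refine Finset.sum_congr rfl fun j _ => ?_
    rw [Dg, Matrix.mul_diagonal, ← Nf_star lam X i j, ← RCLike.mul_conj]; ring
  rw [← h2]; simp

lemma Nf_norm_diag
    {n ℓ : ℕ} (lam : Fin n → ℝ)
    (X : Matrix (Fin n) (Fin ℓ) K) (i : Fin n) : ‖Nf (Dg lam) X i i‖ ^ 2 = (RCLike.re (Nf (Dg lam) X i i)) ^ 2 := by
  rw [← Nf_diag_real]; simp

lemma Nf_nonneg
    {n ℓ : ℕ} (lam : Fin n → ℝ) (hl : ∀ i, 0 ≤ lam i)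
    (X : Matrix (Fin n) (Fin ℓ) K) (h : (Xᴴ * (Dg lam : Matrix (Fin n) (Fin n) K) * X).det ≠ 0) (i : Fin n) : 0 ≤ RCLike.re (Nf (Dg lam) X i i) := by
  rw [← Nf_sum lam X h]
  exact Finset.sum_nonneg fun j _ => mul_nonneg (hl j) (by positivity)

lemma Nf_trace'
    {n ℓ : ℕ} (lam : Fin n → ℝ)
    (X : Matrix (Fin n) (Fin ℓ) K) (h : (Xᴴ * (Dg lam : Matrix (Fin n) (Fin n) K) * X).det ≠ 0) : ∑ i, lam i * RCLike.re (Nf (Dg lam) X i i) = ℓ := by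
  have := Nf_trace (Dg lam) X h
  have h2 : ((∑ i, lam i * RCLike.re (Nf (Dg lam) X i i) : ℝ) : K) = ((ℓ : ℝ) : K) := by
    push_cast
    rw [← this, Matrix.trace]
    refine Finset.sum_congr rfl fun j _ => ?_
    rw [Matrix.diag_apply, Matrix.diagonal_mul]
    exact congrArg (fun z => (lam j : K) * z) (Nf_diag_real lam X j)
  exact_mod_cast h2

lemma Nf_le
    {n ℓ : ℕ} (lam : Fin n → ℝ) (hl : ∀ i, 0 ≤ lam i)
    (X : Matrix (Fin n) (Fin ℓ) K) (h : (Xᴴ * (Dg lam : Matrix (Fin n) (Fin n) K) * X).det ≠ 0) (i : Fin n) (hi : 0 < lam i) : RCLike.re (Nf (Dg lam) X i i) ≤ 1 / lam i := by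
  have h1 : lam i * ‖Nf (Dg lam) X i i‖ ^ 2 ≤ RCLike.re (Nf (Dg lam) X i i) := by
    rw [← Nf_sum lam X h i]
    exact Finset.single_le_sum (f := fun j => lam j * ‖Nf (Dg lam) X i j‖ ^ 2)
      (fun j _ => mul_nonneg (hl j) (by positivity)) (Finset.mem_univ i)
  rw [Nf_norm_diag] at h1
  rw [le_div_iff₀ hi]
  have h0 := Nf_nonneg lam hl X h i
  rcases h0.eq_or_lt with h0 | h0
  · rw [← h0]; simp
  · nlinarith

lemma Nf_norm_le
    {n ℓ : ℕ} (lam : Fin n → ℝ) (hl : ∀ i, 0 ≤ lam i)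
    (X : Matrix (Fin n) (Fin ℓ) K) (h : (Xᴴ * (Dg lam : Matrix (Fin n) (Fin n) K) * X).det ≠ 0) (i j : Fin n) (hi : 0 < lam i) (hj : 0 < lam j) (C : ℝ) (hC : 0 ≤ C)
    (hCi : 1 / lam i ≤ C) (hCj : 1 / lam j ≤ C) : ‖Nf (Dg lam) X i j‖ ≤ C := by
  have h1 : lam j * ‖Nf (Dg lam) X i j‖ ^ 2 ≤ RCLike.re (Nf (Dg lam) X i i) := by
    rw [← Nf_sum lam X h i]
    exact Finset.single_le_sum (f := fun j => lam j * ‖Nf (Dg lam) X i j‖ ^ 2)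
      (fun j _ => mul_nonneg (hl j) (by positivity)) (Finset.mem_univ j)
  have h2 := (h1.trans (Nf_le lam hl X h i hi)).trans hCi
  have h3 : ‖Nf (Dg lam) X i j‖ ^ 2 ≤ C * (1 / lam j) := by
    rw [mul_one_div, le_div_iff₀ hj]; linarith
  have h4 : C * (1 / lam j) ≤ C * C := mul_le_mul_of_nonneg_left hCj hC
  exact abs_le_of_sq_le_sq' (by nlinarith) hC |>.2

end diag
end aux3

section aux4
variable {K : Type*} [RCLike K]

lemma Nf_entry {n ℓ : ℕ} (A : Matrix (Fin n) (Fin n) K) (X : Matrix (Fin n) (Fin ℓ) K)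
    (a b : Fin n) :
    Nf A X a b = ((Xᴴ * A * X).det)⁻¹ * (X * (Xᴴ * A * X).adjugate * Xᴴ) a b := by
  rw [Nf, Matrix.inv_def, Ring.inverse_eq_inv', Matrix.mul_smul, Matrix.smul_mul]
  rfl

lemma measurable_Nf [MeasurableSpace K] [BorelSpace K] {n ℓ : ℕ} (A : Matrix (Fin n) (Fin n) K)
    (a b : Fin n) : Measurable fun X : Matrix (Fin n) (Fin ℓ) K => Nf A X a b := by
  simp only [Nf_entry]
  have h1 : Continuous fun X : Matrix (Fin n) (Fin ℓ) K => (Xᴴ * A * X).det := by fun_prop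
  have h2 : Continuous fun X : Matrix (Fin n) (Fin ℓ) K =>
      (X * (Xᴴ * A * X).adjugate * Xᴴ) a b := by
    apply Continuous.matrix_elem
    fun_prop
  exact h1.measurable.inv.mul h2.measurable

lemma givens_continuous {n : ℕ} (i j : Fin n) :
    Continuous fun t : ℝ => (givens i j (Real.cos t) (Real.sin t) : Matrix (Fin n) (Fin n) K) := by
  refine continuous_matrix fun a b => ?_
  have h1 : Continuous fun t : ℝ => ((Real.cos t : ℝ) : K) :=
    RCLike.continuous_ofReal.comp Real.continuous_cos
  have h2 : Continuous fun t : ℝ => ((Real.sin t : ℝ) : K) :=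
    RCLike.continuous_ofReal.comp Real.continuous_sin
  simp only [givens, Matrix.of_apply]
  split_ifs <;> first | exact h1 | exact h2 | exact h2.neg | exact continuous_const

lemma givens_zero {n : ℕ} (i j : Fin n) :
    (givens i j 1 0 : Matrix (Fin n) (Fin n) K) = 1 := by
  ext a b
  simp only [givens, Matrix.of_apply, Matrix.one_apply]
  by_cases h1 : a = i <;> by_cases h2 : a = j <;> by_cases h3 : b = i <;> by_cases h4 : b = j <;>
    by_cases h5 : a = b <;> simp_all

lemma Nf_tendsto {n ℓ : ℕ} (i j : Fin n) (A : Matrix (Fin n) (Fin n) K)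
    (X : Matrix (Fin n) (Fin ℓ) K) (h : (Xᴴ * A * X).det ≠ 0) (a b : Fin n) :
    Tendsto (fun t : ℝ => Nf ((givens i j (Real.cos t) (Real.sin t))ᴴ * A *
      givens i j (Real.cos t) (Real.sin t)) X a b) (𝓝[≠] 0) (𝓝 (Nf A X a b)) := by
  have hg := givens_continuous (K := K) i j
  have h1 : Continuous fun t : ℝ => (Xᴴ * ((givens i j (Real.cos t) (Real.sin t))ᴴ * A *
      givens i j (Real.cos t) (Real.sin t)) * X) := by fun_prop
  have h0 : (Xᴴ * ((givens i j (Real.cos 0) (Real.sin 0))ᴴ * A *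
      givens i j (Real.cos 0) (Real.sin 0)) * X) = Xᴴ * A * X := by
    simp [givens_zero]
  have h2 : Continuous fun t : ℝ => (X * (Xᴴ * ((givens i j (Real.cos t) (Real.sin t))ᴴ * A *
      givens i j (Real.cos t) (Real.sin t)) * X).adjugate * Xᴴ) a b := by
    apply Continuous.matrix_elem
    fun_prop
  have h3 := ((h1.matrix_det).continuousAt (x := 0)).inv₀ (by rw [h0]; exact h)
  have h4 := (h3.mul h2.continuousAt).tendsto
  rw [Nf_entry A, ← h0]
  exact (h4.mono_left nhdsWithin_le_nhds).congr (fun t => (Nf_entry _ X a b).symm)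

/-- algebraic identity for a rotation in the (i,j) plane -/
lemma rot_algebra {n ℓ : ℕ} (lam : Fin n → ℝ) (X : Matrix (Fin n) (Fin ℓ) K)
    (i j : Fin n) (hij : i ≠ j) (c s : ℝ) (hcs : c ^ 2 + s ^ 2 = 1)
    (N N' : Matrix (Fin n) (Fin n) K) (hN : N = Nf (Dg lam) X)
    (hN' : N' = Nf ((givens i j c s)ᴴ * Dg lam * givens i j c s) X)
    (h : (Xᴴ * (Dg lam : Matrix (Fin n) (Fin n) K) * X).det ≠ 0)
    (h' : (Xᴴ * ((givens i j c s)ᴴ * (Dg lam : Matrix (Fin n) (Fin n) K) * givens i j c s)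
      * X).det ≠ 0) :
    (s : K) * ((c : K) * (N' j j - N' i i) - s * (N' i j + N' j i) - ((lam i : K) - lam j) *
      (- s * (N i i * N' i j) + c * (N i i * N' j j) + c * (N i j * N' i j) + s * (N i j * N' j j)))
      = Nf (Dg lam) ((givens i j c s : Matrix (Fin n) (Fin n) K) * X) i j - N i j := by
  have hK : (c : K) ^ 2 + (s : K) ^ 2 = 1 := by exact_mod_cast congrArg (fun x : ℝ => (x : K)) hcs
  have hji := hij.symm
  have e1 : Nf (Dg lam) ((givens i j c s : Matrix (Fin n) (Fin n) K) * X) i j =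
      (c : K) * (-(s : K) * N' i i + c * N' i j) + s * (-(s : K) * N' j i + c * N' j j) := by
    rw [Nf_mul_left, ← hN', Matrix.mul_assoc, givens_mul i j hij]
    have : ∀ a, (N' * (givens i j c s : Matrix (Fin n) (Fin n) K)ᴴ) a j = -(s : K) * N' a i + c * N' a j := by
      intro a
      have h1 := givens_mul i j hij c s (N'ᴴ) j a
      have h2 : N' * (givens i j c s)ᴴ = ((givens i j c s : Matrix (Fin n) (Fin n) K) * N'ᴴ)ᴴ := by
        simp
      rw [h2, Matrix.conjTranspose_apply, h1]
      simp [hji]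
    simp [this]
  have e2 := congrFun (congrFun (Nf_resolvent (Dg lam) _ X h h') i) j
  rw [← hN', ← hN] at e2
  have hNh : Nᴴ = N := by rw [hN]; exact Nf_herm _ (Dg_herm lam) X
  have hst : ∀ a b, (starRingEnd K) (N a b) = N b a := by
    intro a b; rw [hN]; exact Nf_star lam X a b
  have e3 : (N * ((givens i j c s : Matrix (Fin n) (Fin n) K)ᴴ * (Dg lam : Matrix (Fin n) (Fin n) K) *
      (givens i j c s : Matrix (Fin n) (Fin n) K)) * N') i j
      = ∑ a, (starRingEnd K) (((givens i j c s : Matrix (Fin n) (Fin n) K) * N) a i) *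
        (lam a : K) * ((givens i j c s : Matrix (Fin n) (Fin n) K) * N') a j := by
    have : N * ((givens i j c s : Matrix (Fin n) (Fin n) K)ᴴ * (Dg lam : Matrix (Fin n) (Fin n) K) * givens i j c s) * N'
        = ((givens i j c s : Matrix (Fin n) (Fin n) K) * N)ᴴ * Dg lam *
          ((givens i j c s : Matrix (Fin n) (Fin n) K) * N') := by
      rw [Matrix.conjTranspose_mul, hNh]; simp only [Matrix.mul_assoc]
    rw [this, Matrix.mul_apply]
    refine Finset.sum_congr rfl fun a _ => ?_
    rw [Matrix.mul_diagonal, Matrix.conjTranspose_apply]; rfl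
  have e4 : (N * (Dg lam : Matrix (Fin n) (Fin n) K) * N') i j
      = ∑ a, N i a * (lam a : K) * N' a j := by
    rw [Matrix.mul_apply]
    refine Finset.sum_congr rfl fun a _ => ?_
    rw [Matrix.mul_diagonal]
  rw [Matrix.sub_apply, Matrix.sub_apply, e3, e4, ← Finset.sum_sub_distrib,
    ← Finset.sum_subset (Finset.subset_univ {i, j}), Finset.sum_pair hij] at e2
  · simp only [givens_mul i j hij, if_true, if_neg hji, map_add, map_mul, map_neg, hst,
      RCLike.conj_ofReal] at e2
    rw [e1]
    linear_combination (-N' i j + (N i j) * lam j * N' j j + N i i * lam i * N' i j) * hK + e2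
  · intro a _ ha
    simp only [Finset.mem_insert, Finset.mem_singleton, not_or] at ha
    simp [givens_mul i j hij, ha.1, ha.2, hst]

end aux4

section aux5
variable {K : Type*} [RCLike K]

lemma givens_mul_bound {n : ℕ} {m : Type*} (i j : Fin n) (hij : i ≠ j) (c s : ℝ)
    (hc : |c| ≤ 1) (hs : |s| ≤ 1) (W : Matrix (Fin n) m K) (C : ℝ) (b : m)
    (h1 : ‖W i b‖ ≤ C) (h2 : ‖W j b‖ ≤ C) (a : Fin n) (ha : a = i ∨ a = j) :
    ‖((givens i j c s : Matrix (Fin n) (Fin n) K) * W) a b‖ ≤ 2 * C := by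
  have hc' : ‖(c : K)‖ ≤ 1 := by simpa using hc
  have hs' : ‖(s : K)‖ ≤ 1 := by simpa using hs
  have e : ∀ (x y : K), ‖x‖ ≤ 1 → ‖y‖ ≤ C → ‖x * y‖ ≤ C := fun x y hx hy => by
    rw [norm_mul]; nlinarith [norm_nonneg x, norm_nonneg y]
  rw [givens_mul i j hij]
  rcases ha with rfl | rfl
  · rw [if_pos rfl]
    refine (norm_add_le _ _).trans ?_
    linarith [e _ _ hc' h1, e _ _ hs' h2]
  · rw [if_neg hij.symm, if_pos rfl]
    refine (norm_add_le _ _).trans ?_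
    linarith [e _ _ (by simpa using hs' : ‖-(s : K)‖ ≤ 1) h1, e _ _ hc' h2]

lemma givens_conj_bound {n : ℕ} (i j : Fin n) (hij : i ≠ j) (c s : ℝ)
    (hc : |c| ≤ 1) (hs : |s| ≤ 1) (W : Matrix (Fin n) (Fin n) K) (C : ℝ)
    (hW : ∀ a b, (a = i ∨ a = j) → (b = i ∨ b = j) → ‖W a b‖ ≤ C)
    (a b : Fin n) (ha : a = i ∨ a = j) (hb : b = i ∨ b = j) :
    ‖((givens i j c s : Matrix (Fin n) (Fin n) K) * W *
      (givens i j c s : Matrix (Fin n) (Fin n) K)ᴴ) a b‖ ≤ 4 * C := by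
  have h2 : (givens i j c s : Matrix (Fin n) (Fin n) K) * W *
      (givens i j c s : Matrix (Fin n) (Fin n) K)ᴴ
      = ((givens i j c s : Matrix (Fin n) (Fin n) K) *
        ((givens i j c s : Matrix (Fin n) (Fin n) K) * W)ᴴ)ᴴ := by
    simp
  rw [h2, Matrix.conjTranspose_apply, norm_star]
  have := givens_mul_bound i j hij c s hc hs
    (((givens i j c s : Matrix (Fin n) (Fin n) K) * W)ᴴ) (2 * C) a ?_ ?_ b hb
  · linarith
  · rw [Matrix.conjTranspose_apply, norm_star]
    exact givens_mul_bound i j hij c s hc hs W C i (hW i i (by simp) (by simp))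
      (hW j i (by simp) (by simp)) a ha
  · rw [Matrix.conjTranspose_apply, norm_star]
    exact givens_mul_bound i j hij c s hc hs W C j (hW i j (by simp) (by simp))
      (hW j j (by simp) (by simp)) a ha

variable [MeasurableSpace K] [BorelSpace K]

lemma mp_integral {α : Type*} [MeasurableSpace α] {ν : Measure α} {g : α → α}
    (h : MeasurePreserving g ν ν) (f : α → K) (hf : Measurable f) :
    ∫ x, f (g x) ∂ν = ∫ x, f x ∂ν := by
  conv_rhs => rw [← h.map_eq]
  rw [integral_map h.measurable.aemeasurable hf.aestronglyMeasurable]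

lemma rot_identity {n ℓ : ℕ} (ν : Measure (Matrix (Fin n) (Fin ℓ) K)) [IsProbabilityMeasure ν]
    (hinv : ∀ U ∈ Matrix.unitaryGroup (Fin n) K, MeasurePreserving (fun X => U * X) ν ν)
    (lam : Fin n → ℝ) (hl : ∀ i, 0 ≤ lam i)
    (hns : ∀ᵐ X ∂ν, (Xᴴ * (Dg lam : Matrix (Fin n) (Fin n) K) * X).det ≠ 0)
    (i j : Fin n) (hij : i ≠ j) (hi : 0 < lam i) (hj : 0 < lam j) :
    ∫ X, (Nf (Dg lam) X j j - Nf (Dg lam) X i i - ((lam i : K) - lam j) *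
      (Nf (Dg lam) X i i * Nf (Dg lam) X j j + Nf (Dg lam) X i j * Nf (Dg lam) X i j)) ∂ν = 0 := by
  set C : ℝ := 1 / lam i + 1 / lam j with hC
  have hC0 : 0 ≤ C := by positivity
  have hN : ∀ X : Matrix (Fin n) (Fin ℓ) K,
      (Xᴴ * (Dg lam : Matrix (Fin n) (Fin n) K) * X).det ≠ 0 →
      ∀ a b, (a = i ∨ a = j) → (b = i ∨ b = j) → ‖Nf (Dg lam) X a b‖ ≤ C := by
    intro X hX a b ha hb
    have key : ∀ a, (a = i ∨ a = j) → 0 < lam a ∧ 1 / lam a ≤ C := by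
      rintro a (rfl | rfl)
      · exact ⟨hi, by rw [hC]; linarith [one_div_pos.2 hj]⟩
      · exact ⟨hj, by rw [hC]; linarith [one_div_pos.2 hi]⟩
    exact Nf_norm_le lam hl X hX a b (key a ha).1 (key b hb).1 C hC0 (key a ha).2 (key b hb).2
  let G : ℝ → Matrix (Fin n) (Fin n) K := fun t => givens i j (Real.cos t) (Real.sin t)
  have hcs : ∀ t, Real.cos t ^ 2 + Real.sin t ^ 2 = 1 := Real.cos_sq_add_sin_sq
  have hG : ∀ t, G t ∈ Matrix.unitaryGroup (Fin n) K := fun t => givens_unitary i j hij _ _ (hcs t)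
  let N' : ℝ → Matrix (Fin n) (Fin ℓ) K → Matrix (Fin n) (Fin n) K := fun t X =>
    Nf ((G t)ᴴ * Dg lam * G t) X
  let F : ℝ → Matrix (Fin n) (Fin ℓ) K → K := fun t X =>
    ((Real.cos t : ℝ) : K) * (N' t X j j - N' t X i i)
      - ((Real.sin t : ℝ) : K) * (N' t X i j + N' t X j i) - ((lam i : K) - lam j) *
      (- ((Real.sin t : ℝ) : K) * (Nf (Dg lam) X i i * N' t X i j)
        + ((Real.cos t : ℝ) : K) * (Nf (Dg lam) X i i * N' t X j j)
        + ((Real.cos t : ℝ) : K) * (Nf (Dg lam) X i j * N' t X i j)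
        + ((Real.sin t : ℝ) : K) * (Nf (Dg lam) X i j * N' t X j j))
  have hns' : ∀ t, ∀ᵐ X ∂ν,
      ((G t * X)ᴴ * (Dg lam : Matrix (Fin n) (Fin n) K) * (G t * X)).det ≠ 0 := fun t =>
    (hinv _ (hG t)).quasiMeasurePreserving.ae hns
  have hre : ∀ t (X : Matrix (Fin n) (Fin ℓ) K),
      (G t * X)ᴴ * (Dg lam : Matrix (Fin n) (Fin n) K) * (G t * X)
      = Xᴴ * ((G t)ᴴ * (Dg lam : Matrix (Fin n) (Fin n) K) * G t) * X := by
    intro t X; simp only [Matrix.conjTranspose_mul, Matrix.mul_assoc]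
  have hmeasN : ∀ a b, Measurable fun X : Matrix (Fin n) (Fin ℓ) K => Nf (Dg lam) X a b :=
    fun a b => measurable_Nf _ a b
  have hmeasN' : ∀ t a b, Measurable fun X : Matrix (Fin n) (Fin ℓ) K => N' t X a b :=
    fun t a b => measurable_Nf _ a b
  have hFmeas : ∀ t, Measurable (F t) := by
    intro t
    have := hmeasN; have := hmeasN' t
    simp only [F]
    fun_prop
  have hN'b : ∀ t (X : Matrix (Fin n) (Fin ℓ) K),
      ((G t * X)ᴴ * (Dg lam : Matrix (Fin n) (Fin n) K) * (G t * X)).det ≠ 0 →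
      ∀ a b, (a = i ∨ a = j) → (b = i ∨ b = j) → ‖N' t X a b‖ ≤ 4 * C := by
    intro t X hX a b ha hb
    have e0 : (G t)ᴴ * G t = 1 := by
      have := (Matrix.mem_unitaryGroup_iff').1 (hG t)
      simpa [Matrix.star_eq_conjTranspose] using this
    have e1 : N' t X = (G t)ᴴ * Nf (Dg lam) (G t * X) * ((G t)ᴴ)ᴴ := by
      rw [Nf_mul_left, Matrix.conjTranspose_conjTranspose]
      calc N' t X = 1 * N' t X * 1 := by simp
        _ = ((G t)ᴴ * G t) * N' t X * ((G t)ᴴ * G t) := by rw [e0]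
        _ = _ := by simp only [N', Matrix.mul_assoc]
    rw [e1]
    have e2 : (G t)ᴴ = givens i j (Real.cos t) (-Real.sin t) := givens_conjTranspose i j hij _ _
    rw [e2]
    exact givens_conj_bound i j hij _ _ (Real.abs_cos_le_one t)
      (by rw [abs_neg]; exact Real.abs_sin_le_one t) _ C (hN _ hX) a b ha hb
  have hlim : Tendsto (fun t => ∫ X, F t X ∂ν) (𝓝[≠] 0)
      (𝓝 (∫ X, (Nf (Dg lam) X j j - Nf (Dg lam) X i i - ((lam i : K) - lam j) *
      (Nf (Dg lam) X i i * Nf (Dg lam) X j j + Nf (Dg lam) X i j * Nf (Dg lam) X i j)) ∂ν)) := by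
    refine tendsto_integral_filter_of_dominated_convergence
      (fun _ => 16 * C + ‖(lam i : K) - lam j‖ * (4 * (C * (4 * C)))) ?_ ?_ ?_ ?_
    · exact Eventually.of_forall fun t => (hFmeas t).aestronglyMeasurable
    · refine Eventually.of_forall fun t => ?_
      filter_upwards [hns, hns' t] with X hX hX'
      have b1 := hN X hX
      have b2 := hN'b t X hX'
      have hc' : ‖((Real.cos t : ℝ) : K)‖ ≤ 1 := by simpa using Real.abs_cos_le_one t
      have hs' : ‖((Real.sin t : ℝ) : K)‖ ≤ 1 := by simpa using Real.abs_sin_le_one t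
      have hs'' : ‖-((Real.sin t : ℝ) : K)‖ ≤ 1 := by rw [norm_neg]; exact hs'
      have e : ∀ (x y : K) (B : ℝ), ‖x‖ ≤ 1 → ‖y‖ ≤ B → ‖x * y‖ ≤ B := fun x y B hx hy => by
        rw [norm_mul]; nlinarith [norm_nonneg x, norm_nonneg y]
      have e' : ∀ (x y : K), ‖x‖ ≤ C → ‖y‖ ≤ 4 * C → ‖x * y‖ ≤ C * (4 * C) := fun x y hx hy => by
        rw [norm_mul]; exact mul_le_mul hx hy (norm_nonneg _) hC0
      have g1 := e _ _ (8 * C) hc' ((norm_sub_le (N' t X j j) (N' t X i i)).trans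
        (by linarith [b2 j j (by simp) (by simp), b2 i i (by simp) (by simp)]))
      have g2 := e _ _ (8 * C) hs' ((norm_add_le (N' t X i j) (N' t X j i)).trans
        (by linarith [b2 i j (by simp) (by simp), b2 j i (by simp) (by simp)]))
      have g3 := e _ _ _ hs'' (e' _ _ (b1 i i (by simp) (by simp)) (b2 i j (by simp) (by simp)))
      have g4 := e _ _ _ hc' (e' _ _ (b1 i i (by simp) (by simp)) (b2 j j (by simp) (by simp)))
      have g5 := e _ _ _ hc' (e' _ _ (b1 i j (by simp) (by simp)) (b2 i j (by simp) (by simp)))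
      have g6 := e _ _ _ hs' (e' _ _ (b1 i j (by simp) (by simp)) (b2 j j (by simp) (by simp)))
      refine (norm_sub_le _ _).trans (add_le_add ((norm_sub_le _ _).trans (by linarith)) ?_)
      rw [norm_mul]
      refine mul_le_mul_of_nonneg_left ?_ (norm_nonneg _)
      refine (norm_add_le _ _).trans ?_
      refine (add_le_add ((norm_add_le _ _).trans (add_le_add (norm_add_le _ _) le_rfl))
        le_rfl).trans ?_
      linarith
    · exact integrable_const _
    · filter_upwards [hns] with X hX
      have t1 := fun a b => Nf_tendsto i j (Dg lam) X hX a b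
      have c1 : Tendsto (fun t : ℝ => ((Real.cos t : ℝ) : K)) (𝓝[≠] 0) (𝓝 1) := by
        have := ((RCLike.continuous_ofReal (K := K)).comp Real.continuous_cos).tendsto 0
        simp only [Function.comp_apply, Real.cos_zero, RCLike.ofReal_one] at this
        exact this.mono_left nhdsWithin_le_nhds
      have c2 : Tendsto (fun t : ℝ => ((Real.sin t : ℝ) : K)) (𝓝[≠] 0) (𝓝 0) := by
        have := ((RCLike.continuous_ofReal (K := K)).comp Real.continuous_sin).tendsto 0
        simp only [Function.comp_apply, Real.sin_zero, RCLike.ofReal_zero] at this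
        exact this.mono_left nhdsWithin_le_nhds
      have := ((c1.mul ((t1 j j).sub (t1 i i))).sub (c2.mul ((t1 i j).add (t1 j i)))).sub
        (((((c2.neg.mul ((t1 i j).const_mul (Nf (Dg lam) X i i))).add
          (c1.mul ((t1 j j).const_mul (Nf (Dg lam) X i i)))).add
          (c1.mul ((t1 i j).const_mul (Nf (Dg lam) X i j)))).add
          (c2.mul ((t1 j j).const_mul (Nf (Dg lam) X i j)))).const_mul ((lam i : K) - lam j))
      refine Tendsto.congr' (Eventually.of_forall fun t => ?_) (this.trans (le_of_eq ?_))
      · rfl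
      · congr 1; ring
  have hint : Integrable (fun X => Nf (Dg lam) X i j) ν :=
    Integrable.of_bound (hmeasN i j).aestronglyMeasurable C (by
      filter_upwards [hns] with X hX using hN X hX i j (by simp) (by simp))
  have hzero : ∀ᶠ t in 𝓝[≠] (0 : ℝ), ∫ X, F t X ∂ν = 0 := by
    have hsin : ∀ᶠ t in 𝓝[≠] (0 : ℝ), Real.sin t ≠ 0 := by
      have h1 : ∀ᶠ t in 𝓝[≠] (0 : ℝ), t ∈ Set.Ioo (-Real.pi) Real.pi :=
        nhdsWithin_le_nhds (Ioo_mem_nhds (by linarith [Real.pi_pos]) Real.pi_pos)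
      filter_upwards [h1, self_mem_nhdsWithin] with t ht h0 hs
      exact h0 ((Real.sin_eq_zero_iff_of_lt_of_lt ht.1 ht.2).1 hs)
    filter_upwards [hsin] with t ht
    have h1 : ∫ X, ((Real.sin t : ℝ) : K) * F t X ∂ν = 0 := by
      have : ∀ᵐ X ∂ν, ((Real.sin t : ℝ) : K) * F t X
          = Nf (Dg lam) (G t * X) i j - Nf (Dg lam) X i j := by
        filter_upwards [hns, hns' t] with X hX hX'
        rw [hre] at hX'
        exact rot_algebra lam X i j hij _ _ (hcs t) _ _ rfl rfl hX hX'
      rw [integral_congr_ae this, integral_sub _ hint]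
      · rw [mp_integral (hinv _ (hG t)) (fun X => Nf (Dg lam) X i j) (hmeasN i j), sub_self]
      · exact (hinv _ (hG t)).integrable_comp_of_integrable hint
    rw [integral_const_mul] at h1
    exact (mul_eq_zero.1 h1).resolve_left (by exact_mod_cast ht)
  exact tendsto_nhds_unique (hlim.congr' hzero) tendsto_const_nhds

end aux5

section aux6
variable {K : Type*} [RCLike K] [MeasurableSpace K] [BorelSpace K]

lemma phase_identity {n ℓ : ℕ} (ν : Measure (Matrix (Fin n) (Fin ℓ) K)) [IsProbabilityMeasure ν]
    (hinv : ∀ U ∈ Matrix.unitaryGroup (Fin n) K, MeasurePreserving (fun X => U * X) ν ν)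
    (lam : Fin n → ℝ) (hI : (RCLike.I : K) ≠ 0) (i j : Fin n) (hij : i ≠ j) :
    ∫ X, Nf (Dg lam) X i j * Nf (Dg lam) X i j ∂ν = 0 := by
  have hII : (RCLike.I : K) * RCLike.I = -1 := RCLike.I_mul_I_of_nonzero hI
  let d : Fin n → K := fun a => if a = i then RCLike.I else 1
  let U : Matrix (Fin n) (Fin n) K := Matrix.diagonal d
  have hd : ∀ a, star (d a) * d a = 1 := by
    intro a
    by_cases ha : a = i
    · simp [d, ha, hII]
    · simp [d, ha]
  have hUs : Uᴴ = Matrix.diagonal (star d) := Matrix.diagonal_conjTranspose d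
  have hU : U ∈ Matrix.unitaryGroup (Fin n) K := by
    rw [Matrix.mem_unitaryGroup_iff', Matrix.star_eq_conjTranspose, hUs, Matrix.diagonal_mul_diagonal]
    simp only [Pi.star_apply, hd, Matrix.diagonal_one]
  have hUD : Uᴴ * (Dg lam : Matrix (Fin n) (Fin n) K) * U = Dg lam := by
    rw [hUs, Matrix.diagonal_mul_diagonal, Matrix.diagonal_mul_diagonal]
    congr 1
    ext a
    rw [mul_right_comm, Pi.star_apply, hd, one_mul]
  have hN : ∀ X : Matrix (Fin n) (Fin ℓ) K,
      Nf (Dg lam) (U * X) i j = RCLike.I * Nf (Dg lam) X i j := by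
    intro X
    rw [Nf_mul_left, hUD, hUs, Matrix.mul_diagonal, Matrix.diagonal_mul]
    simp [d, hij.symm]
  have h := mp_integral (hinv U hU) (fun X => Nf (Dg lam) X i j * Nf (Dg lam) X i j)
    ((measurable_Nf _ i j).mul (measurable_Nf _ i j))
  simp only [hN] at h
  have h2 : ∀ X : Matrix (Fin n) (Fin ℓ) K, RCLike.I * Nf (Dg lam) X i j *
      (RCLike.I * Nf (Dg lam) X i j) = -(Nf (Dg lam) X i j * Nf (Dg lam) X i j) := by
    intro X; linear_combination (Nf (Dg lam) X i j * Nf (Dg lam) X i j) * hII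
  simp only [h2, integral_neg] at h
  exact self_eq_neg.1 h.symm

/-- leverage scores -/
def xs {n ℓ : ℕ} (lam : Fin n → ℝ) (i : Fin n) (X : Matrix (Fin n) (Fin ℓ) K) : ℝ :=
  lam i * RCLike.re (Nf (Dg lam) X i i)

def ps {n ℓ : ℕ} (lam : Fin n → ℝ) (i j : Fin n) (X : Matrix (Fin n) (Fin ℓ) K) : ℝ :=
  lam i * lam j * ‖Nf (Dg lam) X i j‖ ^ 2

lemma xs_meas {n ℓ : ℕ} (lam : Fin n → ℝ) (i : Fin n) :
    Measurable (xs (K := K) (ℓ := ℓ) lam i) := by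
  have h : Measurable fun X : Matrix (Fin n) (Fin ℓ) K => Nf (Dg lam) X i i :=
    measurable_Nf _ i i
  have h2 : Measurable fun X : Matrix (Fin n) (Fin ℓ) K =>
      lam i * RCLike.re (Nf (Dg lam) X i i) := by fun_prop
  exact h2

lemma ps_meas {n ℓ : ℕ} (lam : Fin n → ℝ) (i j : Fin n) :
    Measurable (ps (K := K) (ℓ := ℓ) lam i j) := by
  have h : Measurable fun X : Matrix (Fin n) (Fin ℓ) K => Nf (Dg lam) X i j :=
    measurable_Nf _ i j
  have h2 : Measurable fun X : Matrix (Fin n) (Fin ℓ) K =>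
      lam i * lam j * ‖Nf (Dg lam) X i j‖ ^ 2 := by fun_prop
  exact h2

lemma xs_mem {n ℓ : ℕ} (lam : Fin n → ℝ) (hl : ∀ i, 0 ≤ lam i) (i : Fin n)
    (X : Matrix (Fin n) (Fin ℓ) K)
    (h : (Xᴴ * (Dg lam : Matrix (Fin n) (Fin n) K) * X).det ≠ 0) :
    0 ≤ xs lam i X ∧ xs lam i X ≤ 1 := by
  refine ⟨mul_nonneg (hl i) (Nf_nonneg lam hl X h i), ?_⟩
  rcases (hl i).eq_or_lt with h0 | h0
  · simp [xs, ← h0]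
  · have := Nf_le lam hl X h i h0
    rw [le_div_iff₀ h0] at this
    rw [xs]; linarith

lemma ps_sum {n ℓ : ℕ} (lam : Fin n → ℝ) (i : Fin n)
    (X : Matrix (Fin n) (Fin ℓ) K)
    (h : (Xᴴ * (Dg lam : Matrix (Fin n) (Fin n) K) * X).det ≠ 0) :
    ∑ j, ps lam i j X = xs lam i X := by
  rw [xs, ← Nf_sum lam X h i, Finset.mul_sum]
  exact Finset.sum_congr rfl fun j _ => by rw [ps]; ring

lemma ps_diag {n ℓ : ℕ} (lam : Fin n → ℝ) (i : Fin n)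
    (X : Matrix (Fin n) (Fin ℓ) K) : ps lam i i X = xs lam i X ^ 2 := by
  rw [ps, xs, Nf_norm_diag]; ring

lemma ps_symm {n ℓ : ℕ} (lam : Fin n → ℝ) (i j : Fin n)
    (X : Matrix (Fin n) (Fin ℓ) K) : ps lam i j X = ps lam j i X := by
  rw [ps, ps, ← Nf_star, RCLike.norm_conj]; ring

lemma ps_nonneg {n ℓ : ℕ} (lam : Fin n → ℝ) (hl : ∀ i, 0 ≤ lam i) (i j : Fin n)
    (X : Matrix (Fin n) (Fin ℓ) K) : 0 ≤ ps lam i j X :=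
  mul_nonneg (mul_nonneg (hl i) (hl j)) (by positivity)

lemma ps_le {n ℓ : ℕ} (lam : Fin n → ℝ) (hl : ∀ i, 0 ≤ lam i) (i j : Fin n) (hij : i ≠ j)
    (X : Matrix (Fin n) (Fin ℓ) K)
    (h : (Xᴴ * (Dg lam : Matrix (Fin n) (Fin n) K) * X).det ≠ 0) :
    ps lam i j X ≤ xs lam i X * (1 - xs lam i X) := by
  have h1 : ∑ k ∈ {i, j}, ps lam i k X ≤ ∑ k, ps lam i k X :=
    Finset.sum_le_sum_of_subset_of_nonneg (Finset.subset_univ _)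
      fun k _ _ => ps_nonneg lam hl i k X
  rw [Finset.sum_pair hij, ps_sum lam i X h, ps_diag] at h1
  nlinarith

lemma exp_symm {n ℓ : ℕ} (ν : Measure (Matrix (Fin n) (Fin ℓ) K)) [IsProbabilityMeasure ν]
    (hinv : ∀ U ∈ Matrix.unitaryGroup (Fin n) K, MeasurePreserving (fun X => U * X) ν ν)
    (lam : Fin n → ℝ) (hl : ∀ i, 0 ≤ lam i)
    (hns : ∀ᵐ X ∂ν, (Xᴴ * (Dg lam : Matrix (Fin n) (Fin n) K) * X).det ≠ 0)
    (i j : Fin n) (hij : i ≠ j) :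
    lam j * (∫ X, xs lam i X ∂ν - ∫ X, xs lam i X * xs lam j X ∂ν
        - alphaK K * ∫ X, ps lam i j X ∂ν) =
    lam i * (∫ X, xs lam j X ∂ν - ∫ X, xs lam i X * xs lam j X ∂ν
        - alphaK K * ∫ X, ps lam i j X ∂ν) := by
  rcases (hl i).eq_or_lt with hi | hi
  · simp [xs, ps, ← hi]
  rcases (hl j).eq_or_lt with hj | hj
  · simp [xs, ps, ← hj]
  set C : ℝ := 1 / lam i + 1 / lam j with hC
  have hC0 : 0 ≤ C := by positivity
  have hN : ∀ a b, (a = i ∨ a = j) → (b = i ∨ b = j) →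
      Integrable (fun X => Nf (Dg lam) X a b) ν ∧ ∀ᵐ X ∂ν, ‖Nf (Dg lam) X a b‖ ≤ C := by
    intro a b ha hb
    have key : ∀ a, (a = i ∨ a = j) → 0 < lam a ∧ 1 / lam a ≤ C := by
      rintro a (rfl | rfl)
      · exact ⟨hi, by rw [hC]; linarith [one_div_pos.2 hj]⟩
      · exact ⟨hj, by rw [hC]; linarith [one_div_pos.2 hi]⟩
    have : ∀ᵐ X ∂ν, ‖Nf (Dg lam) X a b‖ ≤ C := by
      filter_upwards [hns] with X hX
      exact Nf_norm_le lam hl X hX a b (key a ha).1 (key b hb).1 C hC0 (key a ha).2 (key b hb).2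
    exact ⟨Integrable.of_bound (measurable_Nf _ a b).aestronglyMeasurable C this, this⟩
  have hmul : ∀ a b a' b', (a = i ∨ a = j) → (b = i ∨ b = j) → (a' = i ∨ a' = j) →
      (b' = i ∨ b' = j) → Integrable (fun X => Nf (Dg lam) X a b * Nf (Dg lam) X a' b') ν := by
    intro a b a' b' ha hb ha' hb'
    refine Integrable.of_bound
      ((measurable_Nf _ a b).mul (measurable_Nf _ a' b')).aestronglyMeasurable (C * C) ?_
    filter_upwards [(hN a b ha hb).2, (hN a' b' ha' hb').2] with X h1 h2
    rw [norm_mul]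
    exact mul_le_mul h1 h2 (norm_nonneg _) hC0
  have h0 := rot_identity ν hinv lam hl hns i j hij hi hj
  have hA : Integrable (fun X : Matrix (Fin n) (Fin ℓ) K =>
      Nf (Dg lam) X j j - Nf (Dg lam) X i i) ν :=
    (hN j j (by simp) (by simp)).1.sub (hN i i (by simp) (by simp)).1
  have hB0 : Integrable (fun X : Matrix (Fin n) (Fin ℓ) K =>
      Nf (Dg lam) X i i * Nf (Dg lam) X j j + Nf (Dg lam) X i j * Nf (Dg lam) X i j) ν :=
    (hmul i i j j (by simp) (by simp) (by simp) (by simp)).add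
      (hmul i j i j (by simp) (by simp) (by simp) (by simp))
  have hB : Integrable (fun X : Matrix (Fin n) (Fin ℓ) K => ((lam i : K) - lam j) *
      (Nf (Dg lam) X i i * Nf (Dg lam) X j j + Nf (Dg lam) X i j * Nf (Dg lam) X i j)) ν :=
    hB0.const_mul _
  rw [integral_sub hA hB,
    integral_sub (hN j j (by simp) (by simp)).1 (hN i i (by simp) (by simp)).1,
    integral_const_mul, integral_add (hmul i i j j (by simp) (by simp) (by simp) (by simp))
      (hmul i j i j (by simp) (by simp) (by simp) (by simp))] at h0
  have hre := congrArg RCLike.re h0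
  rw [← RCLike.ofReal_sub] at hre
  rw [map_sub, map_sub, RCLike.re_ofReal_mul, map_add, map_zero] at hre
  rw [← integral_re (hN j j (by simp) (by simp)).1, ← integral_re (hN i i (by simp) (by simp)).1,
    ← integral_re (hmul i i j j (by simp) (by simp) (by simp) (by simp))] at hre
  have h5 : RCLike.re (∫ X, Nf (Dg lam) X i j * Nf (Dg lam) X i j ∂ν)
      = alphaK K * ∫ X, ‖Nf (Dg lam) X i j‖ ^ 2 ∂ν := by
    by_cases hI : (RCLike.I : K) = 0
    · rw [← integral_re (hmul i j i j (by simp) (by simp) (by simp) (by simp)), alphaK, if_pos hI,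
        one_mul]
      refine integral_congr_ae (Eventually.of_forall fun X => ?_)
      have hz : ∀ z : K, ((RCLike.re z : ℝ) : K) = z := fun z => by
        conv_rhs => rw [← RCLike.re_add_im z, hI]
        simp
      have : ∀ z : K, RCLike.re (z * z) = ‖z‖ ^ 2 := fun z => by
        obtain ⟨t, rfl⟩ : ∃ t : ℝ, (t : K) = z := ⟨_, hz z⟩
        rw [← RCLike.ofReal_mul, RCLike.ofReal_re, RCLike.norm_ofReal, sq_abs, sq]
      exact this _
    · rw [phase_identity ν hinv lam hI i j hij, alphaK, if_neg hI]; simp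
  rw [h5] at hre
  have h6 : ∀ X : Matrix (Fin n) (Fin ℓ) K, RCLike.re (Nf (Dg lam) X i i * Nf (Dg lam) X j j)
      = RCLike.re (Nf (Dg lam) X i i) * RCLike.re (Nf (Dg lam) X j j) := by
    intro X; rw [← Nf_diag_real lam X i, RCLike.re_ofReal_mul]; simp
  simp only [h6] at hre
  have e1 : ∀ i : Fin n, ∫ X, xs lam i X ∂ν = lam i * ∫ X, RCLike.re (Nf (Dg lam) X i i) ∂ν :=
    fun i => integral_const_mul _ _
  have e2 : ∫ X, xs lam i X * xs lam j X ∂ν = lam i * lam j *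
      ∫ X, RCLike.re (Nf (Dg lam) X i i) * RCLike.re (Nf (Dg lam) X j j) ∂ν := by
    rw [← integral_const_mul]
    congr 1; ext X; simp only [xs]; ring
  have e3 : ∫ X, ps lam i j X ∂ν = lam i * lam j * ∫ X, ‖Nf (Dg lam) X i j‖ ^ 2 ∂ν :=
    integral_const_mul _ _
  rw [e1, e1, e2, e3]
  linear_combination (-(lam i * lam j)) * hre

end aux6

section aux7

lemma comb_bound {ι : Type*} [Fintype ι] [DecidableEq ι] (lam a : ι → ℝ) (z : ι → ι → ℝ)
    (D S : Finset ι) (r q l α : ℝ)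
    (hl : ∀ i, 0 ≤ lam i) (hS : ∀ i, i ∈ S ↔ 0 < lam i) (hDS : D ⊆ S)
    (hr : (S.card : ℝ) = r) (hq : (D.card : ℝ) = q) (hqr : q < r) (hL : 0 < l - q - α)
    (hlr : l ≤ r)
    (ha1 : ∀ i, a i ≤ 1) (hasum : ∑ i ∈ S, a i = l)
    (hkey : ∀ i j, i ≠ j → lam j * z i j = lam i * z j i)
    (hpos : ∀ i j, i ≠ j → 0 ≤ z i j + z j i)
    (hdiff : ∀ i j, i ≠ j → z i j - z j i = a i - a j)
    (H1 : ∀ j ∈ D, (1 - a j) * (l - q - α) ≤ ∑ i ∈ Dᶜ, z i j)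
    (H2 : ∀ i ∈ Dᶜ, ∑ j ∈ D, z j i ≤ q * (1 - a i)) :
    ∑ i, lam i * (1 - a i) ≤ (r - l) / (r - q) * ((1 + q / (l - q - α)) * ∑ i ∈ Dᶜ, lam i) := by
  have h1 : (l - q - α) * ∑ j ∈ D, lam j * (1 - a j) ≤ q * ∑ i ∈ Dᶜ, lam i * (1 - a i) := by
    calc (l - q - α) * ∑ j ∈ D, lam j * (1 - a j)
        = ∑ j ∈ D, lam j * ((1 - a j) * (l - q - α)) := by
          rw [Finset.mul_sum]; exact Finset.sum_congr rfl fun j _ => by ring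
      _ ≤ ∑ j ∈ D, lam j * ∑ i ∈ Dᶜ, z i j :=
          Finset.sum_le_sum fun j hj => mul_le_mul_of_nonneg_left (H1 j hj) (hl j)
      _ = ∑ j ∈ D, ∑ i ∈ Dᶜ, lam i * z j i := by
          refine Finset.sum_congr rfl fun j hj => ?_
          rw [Finset.mul_sum]
          refine Finset.sum_congr rfl fun i hi => hkey i j ?_
          rintro rfl
          exact (Finset.mem_compl.1 hi) hj
      _ = ∑ i ∈ Dᶜ, lam i * ∑ j ∈ D, z j i := by
          rw [Finset.sum_comm]
          exact Finset.sum_congr rfl fun i _ => by rw [Finset.mul_sum]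
      _ ≤ ∑ i ∈ Dᶜ, lam i * (q * (1 - a i)) :=
          Finset.sum_le_sum fun i hi => mul_le_mul_of_nonneg_left (H2 i hi) (hl i)
      _ = q * ∑ i ∈ Dᶜ, lam i * (1 - a i) := by
          rw [Finset.mul_sum]; exact Finset.sum_congr rfl fun j _ => by ring
  have hmono : ∀ i ∈ S, ∀ j ∈ S, lam i ≤ lam j → a i ≤ a j := by
    intro i hi j hj hij
    by_cases h : i = j
    · rw [h]
    have hi' := (hS i).1 hi
    have hj' := (hS j).1 hj
    have k := hkey i j h
    have p := hpos i j h
    have d := hdiff i j h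
    have z1 : 0 ≤ z i j := by
      by_contra hc
      push Not at hc
      have : 0 < z j i := by linarith
      nlinarith [mul_pos hi' this, mul_neg_of_pos_of_neg hj' hc]
    have : lam i * z i j ≤ lam i * z j i := by
      rw [← k]; exact mul_le_mul_of_nonneg_right hij z1
    have := le_of_mul_le_mul_left this hi'
    linarith
  have hanti : AntivaryOn lam (fun i => 1 - a i) (S \ D : Finset ι) := by
    intro i hi j hj hij
    have hi' : i ∈ S := (Finset.mem_sdiff.1 hi).1
    have hj' : j ∈ S := (Finset.mem_sdiff.1 hj).1
    by_contra hc
    push Not at hc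
    have := hmono i hi' j hj' hc.le
    simp only at hij
    linarith
  have hch := hanti.card_mul_sum_le_sum_mul_sum
  have hcard : ((S \ D).card : ℝ) = r - q := by
    rw [Finset.card_sdiff_of_subset hDS, Nat.cast_sub (Finset.card_le_card hDS), hr, hq]
  have hsub : S \ D ⊆ Dᶜ := fun i hi => Finset.mem_compl.2 (Finset.mem_sdiff.1 hi).2
  have hz : ∀ i ∈ Dᶜ, i ∉ S \ D → lam i = 0 := by
    intro i hi hi2
    have : i ∉ S := fun h => hi2 (Finset.mem_sdiff.2 ⟨h, Finset.mem_compl.1 hi⟩)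
    exact le_antisymm (not_lt.1 fun h => this ((hS i).2 h)) (hl i)
  have e1 : ∑ i ∈ S \ D, lam i = ∑ i ∈ Dᶜ, lam i := Finset.sum_subset hsub hz
  have e2 : ∑ i ∈ S \ D, lam i * (1 - a i) = ∑ i ∈ Dᶜ, lam i * (1 - a i) :=
    Finset.sum_subset hsub fun i hi hi2 => by rw [hz i hi hi2, zero_mul]
  have e3 : ∑ i ∈ S \ D, (1 - a i) ≤ r - l := by
    calc ∑ i ∈ S \ D, (1 - a i) ≤ ∑ i ∈ S, (1 - a i) :=
          Finset.sum_le_sum_of_subset_of_nonneg Finset.sdiff_subset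
            fun i _ _ => by linarith [ha1 i]
      _ = r - l := by rw [Finset.sum_sub_distrib, hasum]; simp [hr]
  rw [hcard, e1, e2] at hch
  have hT0 : 0 ≤ ∑ i ∈ Dᶜ, lam i := Finset.sum_nonneg fun i _ => hl i
  have hrq : 0 < r - q := by linarith
  have h3 : ∑ i ∈ Dᶜ, lam i * (1 - a i) ≤ (r - l) / (r - q) * ∑ i ∈ Dᶜ, lam i := by
    rw [div_mul_eq_mul_div, le_div_iff₀ hrq]
    nlinarith [mul_le_mul_of_nonneg_left e3 hT0]
  have hq0 : 0 ≤ q := by rw [← hq]; positivity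
  have h4 : ∑ j ∈ D, lam j * (1 - a j) ≤ q / (l - q - α) * ∑ i ∈ Dᶜ, lam i * (1 - a i) := by
    rw [div_mul_eq_mul_div, le_div_iff₀ hL]; linarith
  have hk : 0 ≤ q / (l - q - α) := div_nonneg hq0 hL.le
  rw [← Finset.sum_add_sum_compl D]
  have h5 := mul_le_mul_of_nonneg_left h3 (show 0 ≤ 1 + q / (l - q - α) by linarith)
  calc _ ≤ (1 + q / (l - q - α)) * ∑ i ∈ Dᶜ, lam i * (1 - a i) := by linarith
    _ ≤ _ := by linarith

variable {K : Type*} [RCLike K] [MeasurableSpace K] [BorelSpace K]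

lemma alphaK_mem (K : Type*) [RCLike K] : 0 ≤ alphaK K ∧ alphaK K ≤ 1 := by
  unfold alphaK; split_ifs <;> norm_num

lemma diag_bound {n ℓ : ℕ} (ν : Measure (Matrix (Fin n) (Fin ℓ) K)) [IsProbabilityMeasure ν]
    (hinv : ∀ U ∈ Matrix.unitaryGroup (Fin n) K, MeasurePreserving (fun X => U * X) ν ν)
    (lam : Fin n → ℝ) (hl : ∀ i, 0 ≤ lam i)
    (hns : ∀ᵐ X ∂ν, (Xᴴ * (Dg lam : Matrix (Fin n) (Fin n) K) * X).det ≠ 0)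
    (D S : Finset (Fin n)) (r q : ℕ) (hS : ∀ i, i ∈ S ↔ 0 < lam i) (hDS : D ⊆ S)
    (hr : S.card = r) (hq : D.card = q) (hlr : ℓ ≤ r) (hL : (q : ℝ) < ℓ - alphaK K) :
    ∫ X, ∑ i, lam i * (1 - xs lam i X) ∂ν ≤
      ((r : ℝ) - ℓ) / (r - q) * ((1 + q / ((ℓ : ℝ) - q - alphaK K)) * ∑ i ∈ Dᶜ, lam i) := by
  obtain ⟨hα0, hα1⟩ := alphaK_mem K
  have hxb : ∀ i, ∀ᵐ X ∂ν, 0 ≤ xs lam i X ∧ xs lam i X ≤ 1 := fun i => by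
    filter_upwards [hns] with X hX using xs_mem lam hl i X hX
  have hx : ∀ i, Integrable (fun X => xs lam i X) ν := fun i => by
    refine Integrable.of_bound (xs_meas lam i).aestronglyMeasurable 1 ?_
    filter_upwards [hxb i] with X h
    rw [Real.norm_eq_abs, abs_le]; constructor <;> linarith
  have hxx : ∀ i j, Integrable (fun X => xs lam i X * xs lam j X) ν := fun i j => by
    refine Integrable.of_bound ((xs_meas lam i).mul (xs_meas lam j)).aestronglyMeasurable 1 ?_
    filter_upwards [hxb i, hxb j] with X h h'
    rw [Real.norm_eq_abs, abs_le]; constructor <;> nlinarith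
  have hpb : ∀ i j, ∀ᵐ X ∂ν, ps lam i j X ≤ 1 := fun i j => by
    filter_upwards [hns, hxb i] with X hX h
    calc ps lam i j X ≤ ∑ k, ps lam i k X :=
          Finset.single_le_sum (f := fun k => ps lam i k X)
            (fun k _ => ps_nonneg lam hl i k X) (Finset.mem_univ j)
      _ ≤ 1 := by rw [ps_sum lam i X hX]; exact h.2
  have hp : ∀ i j, Integrable (fun X => ps lam i j X) ν := fun i j => by
    refine Integrable.of_bound (ps_meas lam i j).aestronglyMeasurable 1 ?_
    filter_upwards [hpb i j] with X h
    have := ps_nonneg lam hl i j X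
    rw [Real.norm_eq_abs, abs_le]; constructor <;> linarith
  have hz : ∀ i j, Integrable (fun X => xs lam i X - xs lam i X * xs lam j X
      - alphaK K * ps lam i j X) ν := fun i j =>
    ((hx i).sub (hxx i j)).sub ((hp i j).const_mul _)
  have hy : ∀ i, Integrable (fun X => 1 - xs lam i X) ν := fun i =>
    (integrable_const _).sub (hx i)
  have hyint : ∀ i, ∫ X, (1 - xs lam i X) ∂ν = 1 - ∫ X, xs lam i X ∂ν := fun i => by
    rw [integral_sub (integrable_const _) (hx i)]; simp
  have hzint : ∀ i j, ∫ X, (xs lam i X - xs lam i X * xs lam j X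
      - alphaK K * ps lam i j X) ∂ν = ∫ X, xs lam i X ∂ν - ∫ X, xs lam i X * xs lam j X ∂ν
        - alphaK K * ∫ X, ps lam i j X ∂ν := fun i j => by
    have h1 : Integrable (fun X => xs lam i X - xs lam i X * xs lam j X) ν := (hx i).sub (hxx i j)
    have h2 : Integrable (fun X => alphaK K * ps lam i j X) ν := (hp i j).const_mul _
    rw [integral_sub h1 h2, integral_sub (hx i) (hxx i j), integral_const_mul]
  have hxsymm : ∀ i j, ∫ X, xs lam i X * xs lam j X ∂ν = ∫ X, xs lam j X * xs lam i X ∂ν :=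
    fun i j => by simp only [mul_comm]
  have hpsymm : ∀ i j, ∫ X, ps lam i j X ∂ν = ∫ X, ps lam j i X ∂ν :=
    fun i j => by simp only [ps_symm lam i j]
  have hsupp : ∀ i, i ∉ S → ∀ X : Matrix (Fin n) (Fin ℓ) K, xs lam i X = 0 := fun i hi X => by
    have : lam i = 0 := le_antisymm (not_lt.1 fun h => hi ((hS i).2 h)) (hl i)
    simp [xs, this]
  have hsum : ∀ᵐ X ∂ν, ∑ i, xs lam i X = ℓ := by
    filter_upwards [hns] with X hX using Nf_trace' lam X hX
  have hLpos : 0 < (ℓ : ℝ) - q - alphaK K := by linarith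
  have hqℓ : (q : ℝ) < r := by
    have : (ℓ : ℝ) ≤ r := by exact_mod_cast hlr
    linarith
  have e0 : ∫ X, ∑ i, lam i * (1 - xs lam i X) ∂ν = ∑ i, lam i * (1 - ∫ X, xs lam i X ∂ν) := by
    rw [integral_finsetSum _ fun i _ => (hy i).const_mul _]
    exact Finset.sum_congr rfl fun i _ => by rw [integral_const_mul, hyint]
  rw [e0]
  refine comb_bound lam (fun i => ∫ X, xs lam i X ∂ν)
    (fun i j => ∫ X, (xs lam i X - xs lam i X * xs lam j X - alphaK K * ps lam i j X) ∂ν)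
    D S r q ℓ (alphaK K) hl hS hDS (by rw [hr]) (by rw [hq]) hqℓ hLpos (by exact_mod_cast hlr)
    ?_ ?_ ?_ ?_ ?_ ?_ ?_
  · intro i
    have := integral_mono_ae (hx i) (integrable_const 1) ((hxb i).mono fun X h => h.2)
    simpa using this
  · rw [← integral_finsetSum _ fun i _ => hx i]
    have : ∀ᵐ X ∂ν, ∑ i ∈ S, xs lam i X = (ℓ : ℝ) := by
      filter_upwards [hsum] with X h
      rw [← h]
      exact Finset.sum_subset (Finset.subset_univ _) fun i _ hi => hsupp i hi X
    rw [integral_congr_ae this]; simp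
  · intro i j hij
    simp only [hzint]
    rw [hxsymm j i, hpsymm j i]
    exact exp_symm ν hinv lam hl hns i j hij
  · intro i j hij
    rw [← integral_add (hz i j) (hz j i)]
    refine integral_nonneg_of_ae ?_
    filter_upwards [hns, hxb i, hxb j] with X hX hi hj
    have p1 := ps_le lam hl i j hij X hX
    have p2 := ps_le lam hl j i hij.symm X hX
    have p0 := ps_nonneg lam hl i j X
    rw [ps_symm lam j i] at p2 ⊢
    generalize xs lam i X = x at *
    generalize xs lam j X = y at *
    generalize ps lam i j X = p at *
    have hle : p ^ 2 ≤ (x * (1 - y)) * (y * (1 - x)) := by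
      have := mul_le_mul p1 p2 p0 (by nlinarith)
      nlinarith
    have h2 : 2 * p ≤ x * (1 - y) + y * (1 - x) := by
      have u : 0 ≤ x * (1 - y) := mul_nonneg hi.1 (by linarith)
      have v : 0 ≤ y * (1 - x) := mul_nonneg hj.1 (by linarith)
      refine abs_le_of_sq_le_sq' (by nlinarith [sq_nonneg (x * (1 - y) - y * (1 - x))])
        (by linarith) |>.2
    have h3 : alphaK K * p ≤ p := by nlinarith
    simp only [Pi.zero_apply]
    nlinarith
  · intro i j hij
    simp only [hzint]
    rw [hxsymm j i, hpsymm j i]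
    ring
  · intro j hj
    rw [← hyint, ← integral_mul_const, ← integral_finsetSum _ fun i _ => hz i j]
    refine integral_mono_ae ((hy j).mul_const _) (integrable_finsetSum _ fun i _ => hz i j) ?_
    filter_upwards [hns, hsum, ae_all_iff.2 hxb] with X hX hs hb
    have s1 : ∑ i ∈ Dᶜ, xs lam i X = ℓ - ∑ i ∈ D, xs lam i X := by
      rw [← hs, ← Finset.sum_add_sum_compl D]; ring
    have s2 : ∑ i ∈ D, xs lam i X ≤ q := by
      calc ∑ i ∈ D, xs lam i X ≤ ∑ i ∈ D, (1 : ℝ) := Finset.sum_le_sum fun i _ => (hb i).2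
        _ = q := by simp [hq]
    have s3 : ∑ i ∈ Dᶜ, ps lam i j X ≤ xs lam j X * (1 - xs lam j X) := by
      have : ∑ i ∈ insert j Dᶜ, ps lam j i X ≤ ∑ i, ps lam j i X :=
        Finset.sum_le_sum_of_subset_of_nonneg (Finset.subset_univ _)
          fun k _ _ => ps_nonneg lam hl j k X
      rw [Finset.sum_insert (by simpa using hj), ps_sum lam j X hX, ps_diag] at this
      simp only [ps_symm lam _ j]
      nlinarith
    have s4 : ∑ i ∈ Dᶜ, (xs lam i X - xs lam i X * xs lam j X - alphaK K * ps lam i j X)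
        = (∑ i ∈ Dᶜ, xs lam i X) * (1 - xs lam j X) - alphaK K * ∑ i ∈ Dᶜ, ps lam i j X := by
      rw [Finset.sum_mul, Finset.mul_sum, ← Finset.sum_sub_distrib]
      exact Finset.sum_congr rfl fun i _ => by ring
    rw [s4, s1]
    have hbj := hb j
    have t1 : (1 - xs lam j X) * (ℓ - q) ≤ (ℓ - ∑ i ∈ D, xs lam i X) * (1 - xs lam j X) := by
      nlinarith
    have t2 : alphaK K * ∑ i ∈ Dᶜ, ps lam i j X ≤ alphaK K * (1 - xs lam j X) :=
      mul_le_mul_of_nonneg_left (by nlinarith) hα0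
    nlinarith
  · intro i hi
    rw [← hyint, ← integral_const_mul, ← integral_finsetSum _ fun j _ => hz j i]
    refine integral_mono_ae (integrable_finsetSum _ fun j _ => hz j i) ((hy i).const_mul _) ?_
    filter_upwards [hns, ae_all_iff.2 hxb] with X hX hb
    calc _ ≤ ∑ j ∈ D, (1 - xs lam i X) := by
          refine Finset.sum_le_sum fun j _ => ?_
          have := ps_nonneg lam hl j i X
          have h1 := hb i
          have h2 := hb j
          nlinarith [mul_nonneg hα0 this]
      _ = q * (1 - xs lam i X) := by rw [Finset.sum_const, hq, nsmul_eq_mul]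

end aux7

section aux8

lemma exists_top {n : ℕ} (lam : Fin n → ℝ) (q : ℕ) (hq : q ≤ n) :
    ∃ D : Finset (Fin n), D.card = q ∧ ∀ i ∈ D, ∀ j ∉ D, lam j ≤ lam i := by
  induction q with
  | zero => exact ⟨∅, by simp⟩
  | succ q ih =>
    obtain ⟨D, hD, h⟩ := ih (by omega)
    have hne : (Dᶜ).Nonempty := by
      rw [← Finset.card_pos, Finset.card_compl, Fintype.card_fin]; omega
    obtain ⟨k, hk, hmax⟩ := Finset.exists_max_image Dᶜ lam hne
    have hk' := Finset.mem_compl.1 hk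
    refine ⟨insert k D, by rw [Finset.card_insert_of_notMem hk', hD], ?_⟩
    intro i hi j hj
    rw [Finset.mem_insert, not_or] at hj
    rcases Finset.mem_insert.1 hi with rfl | hi
    · exact hmax j (Finset.mem_compl.2 hj.2)
    · exact h i hi j hj.2

lemma top_subset {n : ℕ} (lam : Fin n → ℝ) (hl : ∀ i, 0 ≤ lam i) (D S : Finset (Fin n))
    (hS : ∀ i, i ∈ S ↔ 0 < lam i) (h : ∀ i ∈ D, ∀ j ∉ D, lam j ≤ lam i)
    (hc : D.card ≤ S.card) : D ⊆ S := by
  intro i hi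
  by_contra hiS
  have h0 : lam i ≤ 0 := not_lt.1 fun h => hiS ((hS i).2 h)
  have hsub : S ⊆ D.erase i := by
    intro j hj
    have hj' := (hS j).1 hj
    refine Finset.mem_erase.2 ⟨?_, ?_⟩
    · rintro rfl; exact hiS hj
    · by_contra hjD
      linarith [h i hi j hjD]
  have := Finset.card_le_card hsub
  rw [Finset.card_erase_of_mem hi] at this
  have := Finset.card_pos.2 ⟨i, hi⟩
  omega

lemma top_weight {n : ℕ} (lam w : Fin n → ℝ) (hl : ∀ i, 0 ≤ lam i) (D : Finset (Fin n))
    (h : ∀ i ∈ D, ∀ j ∉ D, lam j ≤ lam i) (hw0 : ∀ i, 0 ≤ w i) (hw1 : ∀ i, w i ≤ 1)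
    (hw : ∑ i, w i ≤ D.card) : ∑ i, lam i * w i ≤ ∑ i ∈ D, lam i := by
  obtain ⟨t, ht0, htD, htC⟩ : ∃ t : ℝ, 0 ≤ t ∧ (∀ i ∈ D, t ≤ lam i) ∧ ∀ j ∈ Dᶜ, lam j ≤ t := by
    by_cases hne : (Dᶜ).Nonempty
    · obtain ⟨k, hk, hmax⟩ := Finset.exists_max_image Dᶜ lam hne
      exact ⟨lam k, hl k, fun i hi => h i hi k (Finset.mem_compl.1 hk), hmax⟩
    · rw [Finset.not_nonempty_iff_eq_empty] at hne
      exact ⟨0, le_rfl, fun i _ => hl i, by simp [hne]⟩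
  rw [← Finset.sum_add_sum_compl D] at hw ⊢
  have h1 : ∑ i ∈ D, lam i * w i ≤ ∑ i ∈ D, (lam i + t * w i - t) :=
    Finset.sum_le_sum fun i hi => by nlinarith [htD i hi, hw1 i]
  have h2 : ∑ i ∈ Dᶜ, lam i * w i ≤ ∑ i ∈ Dᶜ, t * w i :=
    Finset.sum_le_sum fun i hi => mul_le_mul_of_nonneg_right (htC i hi) (hw0 i)
  rw [Finset.sum_sub_distrib, Finset.sum_add_distrib, ← Finset.mul_sum, Finset.sum_const,
    nsmul_eq_mul] at h1
  rw [← Finset.mul_sum] at h2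
  nlinarith

variable {K : Type*} [RCLike K]

lemma frobSq_eq {n : ℕ} (A : Matrix (Fin n) (Fin n) K) : frobSq A = RCLike.re (Aᴴ * A).trace := by
  simp only [frobSq, Matrix.trace, Matrix.diag, Matrix.mul_apply, Matrix.conjTranspose_apply,
    map_sum]
  rw [Finset.sum_comm]
  refine Finset.sum_congr rfl fun i _ => Finset.sum_congr rfl fun j _ => ?_
  rw [RCLike.star_def, RCLike.conj_mul]
  norm_cast

lemma frobSq_add {n : ℕ} (A B : Matrix (Fin n) (Fin n) K) (h : Aᴴ * B = 0) :
    frobSq (A + B) = frobSq A + frobSq B := by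
  have h' : Bᴴ * A = 0 := by
    have := congrArg Matrix.conjTranspose h
    simpa using this
  rw [frobSq_eq, frobSq_eq, frobSq_eq, Matrix.conjTranspose_add, Matrix.add_mul, Matrix.mul_add,
    Matrix.mul_add, h, h', add_zero, zero_add, Matrix.trace_add, map_add]

lemma frobSq_zero {n : ℕ} (A : Matrix (Fin n) (Fin n) K) (h : frobSq A ≤ 0) : A = 0 := by
  ext i j
  have h1 : ‖A i j‖ ^ 2 ≤ frobSq A :=
    (Finset.single_le_sum (f := fun j => ‖A i j‖ ^ 2) (fun _ _ => by positivity)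
      (Finset.mem_univ j)).trans
    (Finset.single_le_sum (f := fun i => ∑ j, ‖A i j‖ ^ 2)
      (fun _ _ => Finset.sum_nonneg fun _ _ => by positivity) (Finset.mem_univ i))
  have : ‖A i j‖ = 0 := by nlinarith [norm_nonneg (A i j)]
  simpa using this

lemma best_proj {n q : ℕ} (H Hq G : Matrix (Fin n) (Fin n) K) (hb : IsBestRankApprox q H Hq)
    (hG : IsMoorePenrose Hq G) : Hq = Hq * G * H := by
  obtain ⟨h1, h2, h3, h4⟩ := hG
  have hPP : (Hq * G) * (Hq * G) = Hq * G := by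
    rw [← Matrix.mul_assoc, h1]
  set P := Hq * G with hP
  have hrk : (P * H).rank ≤ q := by
    rw [hP, Matrix.mul_assoc]
    exact (Matrix.rank_mul_le_left _ _).trans hb.1
  have hle := hb.2 (P * H) hrk
  have e : H - Hq = (H - P * H) + (P * H - Hq) := by abel
  have horth : (H - P * H)ᴴ * (P * H - Hq) = 0 := by
    have : P * H - Hq = P * (H - Hq) := by rw [Matrix.mul_sub, h1]
    rw [this, Matrix.conjTranspose_sub, Matrix.conjTranspose_mul, h3, Matrix.sub_mul,
      Matrix.mul_assoc Hᴴ P, ← Matrix.mul_assoc P P, hPP, sub_self]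
  rw [e, frobSq_add _ _ horth] at hle
  have := frobSq_zero (P * H - Hq) (by linarith)
  exact (sub_eq_zero.1 this).symm

lemma proj_diag {n : ℕ} (W : Matrix (Fin n) (Fin n) K) (h1 : Wᴴ = W) (h2 : W * W = W) (i : Fin n) :
    0 ≤ RCLike.re (W i i) ∧ RCLike.re (W i i) ≤ 1 := by
  have e : RCLike.re (W i i) = ∑ j, ‖W i j‖ ^ 2 := by
    conv_lhs => rw [← h2]
    rw [Matrix.mul_apply, map_sum]
    refine Finset.sum_congr rfl fun j _ => ?_
    have : W j i = star (W i j) := by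
      conv_lhs => rw [← h1]
      rfl
    rw [this, RCLike.star_def, RCLike.mul_conj]
    norm_cast
  have hle : ‖W i i‖ ^ 2 ≤ RCLike.re (W i i) := by
    rw [e]
    exact Finset.single_le_sum (f := fun j => ‖W i j‖ ^ 2) (fun _ _ => by positivity)
      (Finset.mem_univ i)
  have hre := RCLike.re_le_norm (W i i)
  have := norm_nonneg (W i i)
  constructor
  · rw [e]; positivity
  · nlinarith

lemma trace_proj {n : ℕ} (P : Matrix (Fin n) (Fin n) K) (h : P * P = P) :
    P.trace = (P.rank : K) := by
  have hi : IsIdempotentElem (Matrix.toLin' P) := by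
    rw [IsIdempotentElem, Module.End.mul_eq_comp, ← Matrix.toLin'_mul, h]
  rw [← Matrix.trace_toLin'_eq, (LinearMap.IsIdempotentElem.isProj_range _ hi).trace]
  rfl

lemma best_trace {n q : ℕ} (H Hq G V : Matrix (Fin n) (Fin n) K) (lam : Fin n → ℝ)
    (hl : ∀ i, 0 ≤ lam i)
    (hV : Vᴴ * V = 1) (hHV : H = V * Dg lam * Vᴴ) (hb : IsBestRankApprox q H Hq)
    (hG : IsMoorePenrose Hq G) (D : Finset (Fin n)) (hD : D.card = q)
    (h : ∀ i ∈ D, ∀ j ∉ D, lam j ≤ lam i) :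
    ∑ i ∈ Dᶜ, lam i ≤ RCLike.re (H - Hq).trace := by
  have hV' : V * Vᴴ = 1 := mul_eq_one_comm.1 hV
  have hproj := best_proj H Hq G hb hG
  obtain ⟨h1, h2, h3, h4⟩ := hG
  have hPP : (Hq * G) * (Hq * G) = Hq * G := by rw [← Matrix.mul_assoc, h1]
  have hrk : (Hq * G).rank ≤ q := (Matrix.rank_mul_le_left _ _).trans hb.1
  generalize Hq * G = P at *
  set W := Vᴴ * P * V with hW
  have hW1 : Wᴴ = W := by
    simp only [hW, Matrix.conjTranspose_mul, Matrix.conjTranspose_conjTranspose, h3,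
      Matrix.mul_assoc]
  have hW2 : W * W = W := by
    calc W * W = Vᴴ * P * (V * Vᴴ) * P * V := by simp only [hW, Matrix.mul_assoc]
      _ = Vᴴ * (P * P) * V := by rw [hV', Matrix.mul_one]; simp only [Matrix.mul_assoc]
      _ = W := by rw [hPP]
  have hWt : W.trace = P.trace := by
    rw [hW, Matrix.trace_mul_comm, ← Matrix.mul_assoc, hV', Matrix.one_mul]
  have hsum : ∑ i, RCLike.re (W i i) ≤ D.card := by
    have : ∑ i, RCLike.re (W i i) = (P.rank : ℝ) := by
      have e := congrArg RCLike.re (hWt.trans (trace_proj P hPP))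
      rw [Matrix.trace, map_sum, RCLike.natCast_re] at e
      exact e
    rw [this, hD]
    exact_mod_cast hrk
  have htr : ∀ B : Matrix (Fin n) (Fin n) K, RCLike.re (B * Dg lam).trace
      = ∑ i, lam i * RCLike.re (B i i) := by
    intro B
    rw [Matrix.trace, map_sum]
    refine Finset.sum_congr rfl fun i _ => ?_
    rw [Matrix.diag_apply, Matrix.mul_diagonal, mul_comm, RCLike.re_ofReal_mul]
  have t1 : RCLike.re Hq.trace = ∑ i, lam i * RCLike.re (W i i) := by
    rw [← htr W, hproj, hHV]
    congr 1
    rw [Matrix.trace_mul_comm, Matrix.mul_assoc, Matrix.trace_mul_comm, hW]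
    simp only [Matrix.mul_assoc]
  have t2 : RCLike.re H.trace = ∑ i, lam i := by
    rw [hHV, Matrix.trace_mul_comm, ← Matrix.mul_assoc, hV, htr]
    simp
  have := top_weight lam (fun i => RCLike.re (W i i)) hl D h
    (fun i => (proj_diag W hW1 hW2 i).1) (fun i => (proj_diag W hW1 hW2 i).2) hsum
  rw [Matrix.trace_sub, map_sub, t1, t2, ← Finset.sum_add_sum_compl D lam]
  linarith

lemma nystrom_trace {n ℓ : ℕ} (H V : Matrix (Fin n) (Fin n) K) (lam : Fin n → ℝ)
    (hV : Vᴴ * V = 1) (hHV : H = V * Dg lam * Vᴴ) (X : Matrix (Fin n) (Fin ℓ) K) :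
    RCLike.re (H - H * Nf H X * H).trace = ∑ i, lam i * (1 - xs lam i (Vᴴ * X)) := by
  have hV' : V * Vᴴ = 1 := mul_eq_one_comm.1 hV
  have hN : Nf (Dg lam) (Vᴴ * X) = Vᴴ * Nf H X * V := by
    rw [Nf_mul_left, Matrix.conjTranspose_conjTranspose, ← hHV]
  have htr : ∀ B : Matrix (Fin n) (Fin n) K, RCLike.re (B * Dg lam).trace
      = ∑ i, lam i * RCLike.re (B i i) := by
    intro B
    rw [Matrix.trace, map_sum]
    refine Finset.sum_congr rfl fun i _ => ?_
    rw [Matrix.diag_apply, Matrix.mul_diagonal, mul_comm, RCLike.re_ofReal_mul]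
  have t2 : RCLike.re H.trace = ∑ i, lam i := by
    rw [hHV, Matrix.trace_mul_comm, ← Matrix.mul_assoc, hV, htr]
    simp
  have t3 : RCLike.re (H * Nf H X * H).trace = ∑ i, lam i * xs lam i (Vᴴ * X) := by
    have : (H * Nf H X * H).trace = (Dg lam * Nf (Dg lam) (Vᴴ * X) * Dg lam).trace := by
      rw [hN]
      calc (H * Nf H X * H).trace
          = (V * (Dg lam * Vᴴ * Nf H X * V * Dg lam * Vᴴ)).trace := by
            conv_lhs => rw [show H * Nf H X * H = (V * Dg lam * Vᴴ) * Nf H X * (V * Dg lam * Vᴴ)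
              by rw [← hHV]]
            simp only [Matrix.mul_assoc]
        _ = _ := by
            rw [Matrix.trace_mul_comm, Matrix.mul_assoc _ Vᴴ V, hV, Matrix.mul_one]
            simp only [Matrix.mul_assoc]
    rw [this, htr]
    refine Finset.sum_congr rfl fun i _ => ?_
    rw [Matrix.diagonal_mul, RCLike.re_ofReal_mul, xs]
  rw [Matrix.trace_sub, map_sub, t2, t3, ← Finset.sum_sub_distrib]
  exact Finset.sum_congr rfl fun i _ => by ring

lemma rank_iff_not_bad {n ℓ : ℕ} (X : Matrix (Fin n) (Fin ℓ) K) : X.rank = ℓ ↔ ¬ Bad ∅ X := by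
  have h := LinearMap.finrank_range_add_finrank_ker X.mulVecLin
  have h1 : X.rank + Module.finrank K (LinearMap.ker X.mulVecLin) = ℓ := by
    rw [Matrix.rank]; simpa using h
  have h2 : X.rank = ℓ ↔ LinearMap.ker X.mulVecLin = ⊥ := by
    rw [← Submodule.finrank_eq_zero (R := K)]; omega
  rw [h2, LinearMap.ker_eq_bot']
  simp only [Bad, not_exists, not_and, Matrix.mulVecLin_apply]
  refine forall_congr' fun c => ?_
  constructor
  · intro h hc h0
    exact hc (h (by ext a; exact h0 a (by simp)))
  · intro h h0
    by_contra hc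
    exact h hc fun a _ => by rw [h0]; rfl

end aux8

/-- **Nyström approximation, sharp upper bound** (Theorem 3.6(a)): for a full-rank
rotation-invariant random embedding `Ω` and any psd matrix `H` with `r = rank H ≥ ℓ`,
`E tr(H − H⟨Ω⟩) ≤ ((r − ℓ)/(r − q)) (1 + q/(ℓ − q − α_K)) tr(H − [H]_q)`
for all `q < ℓ − α_K`. -/
theorem nystrom_sharp_upper_bound
    {K : Type*} [RCLike K] [MeasurableSpace K] [BorelSpace K]
    {Y : Type*} [MeasurableSpace Y] (μ : Measure Y) [IsProbabilityMeasure μ]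
    (pinv : (m n : ℕ) → Matrix (Fin m) (Fin n) K → Matrix (Fin n) (Fin m) K)
    (hpinv : ∀ (m n : ℕ) (A : Matrix (Fin m) (Fin n) K), IsMoorePenrose A (pinv m n A))
    (n ℓ : ℕ) (hℓn : ℓ ≤ n)
    (M : Y → Matrix (Fin n) (Fin ℓ) K)
    (hMmeas : Measurable M)
    (hMfull : ∀ᵐ ω ∂μ, (M ω).rank = ℓ)
    (hMrot : RotationInvariant μ M)
    (H : Matrix (Fin n) (Fin n) K) (hH : H.PosSemidef) (hrank : ℓ ≤ H.rank) :
    ∀ (q : ℕ) (Hq : Matrix (Fin n) (Fin n) K),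
      (q : ℝ) < (ℓ : ℝ) - alphaK K → IsBestRankApprox q H Hq →
      ∫ ω, RCLike.re (Matrix.trace
          (H - H * M ω * (pinv ℓ ℓ ((M ω)ᴴ * H * M ω) * ((M ω)ᴴ * H)))) ∂μ ≤
        ((H.rank : ℝ) - (ℓ : ℝ)) / ((H.rank : ℝ) - (q : ℝ)) *
          ((1 + (q : ℝ) / ((ℓ : ℝ) - (q : ℝ) - alphaK K)) *
            RCLike.re (Matrix.trace (H - Hq))) := by
  intro q Hq hq hbest
  have hα0 := (alphaK_mem K).1
  set ν := Measure.map M μ with hν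
  haveI : IsProbabilityMeasure ν := Measure.isProbabilityMeasure_map hMmeas.aemeasurable
  have hmulmeas : ∀ U : Matrix (Fin n) (Fin n) K,
      Measurable (fun X : Matrix (Fin n) (Fin ℓ) K => U * X) := fun U => by
    have : Continuous (fun X : Matrix (Fin n) (Fin ℓ) K => U * X) := by fun_prop
    exact this.measurable
  have hinv : ∀ U ∈ Matrix.unitaryGroup (Fin n) K,
      MeasurePreserving (fun X : Matrix (Fin n) (Fin ℓ) K => U * X) ν ν := fun U hU => by
    refine ⟨hmulmeas U, ?_⟩
    rw [hν, Measure.map_map (hmulmeas U) hMmeas]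
    exact hMrot U hU
  have hfull : ∀ᵐ X ∂ν, X.rank = ℓ := by
    have hms : MeasurableSet {X : Matrix (Fin n) (Fin ℓ) K | X.rank = ℓ} := by
      simp only [rank_iff_not_bad]
      exact (measurable_bad ∅).compl
    rw [hν, ae_map_iff hMmeas.aemeasurable hms]
    exact hMfull
  have hHerm := hH.isHermitian
  set lam : Fin n → ℝ := hHerm.eigenvalues with hlam
  have hl : ∀ i, 0 ≤ lam i := hH.eigenvalues_nonneg
  set V : Matrix (Fin n) (Fin n) K := (hHerm.eigenvectorUnitary : Matrix (Fin n) (Fin n) K) with hVd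
  have hVmem : V ∈ Matrix.unitaryGroup (Fin n) K := hHerm.eigenvectorUnitary.2
  have hV : Vᴴ * V = 1 := Matrix.mem_unitaryGroup_iff'.1 hVmem
  have hV' : V * Vᴴ = 1 := mul_eq_one_comm.1 hV
  have hVs : Vᴴ ∈ Matrix.unitaryGroup (Fin n) K := by
    rw [Matrix.mem_unitaryGroup_iff', Matrix.star_eq_conjTranspose,
      Matrix.conjTranspose_conjTranspose, hV']
  have hHV : H = V * Dg lam * Vᴴ := by
    conv_lhs => rw [hHerm.spectral_theorem, Unitary.conjStarAlgAut_apply]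
    rfl
  set S : Finset (Fin n) := Finset.univ.filter fun i => 0 < lam i with hSd
  have hS : ∀ i, i ∈ S ↔ 0 < lam i := fun i => by simp [hSd]
  have hScard : S.card = H.rank := by
    rw [hHerm.rank_eq_card_non_zero_eigs, Fintype.card_subtype]
    congr 1
    ext i
    rw [hS i, Finset.mem_filter]
    simp only [Finset.mem_univ, true_and]
    exact ⟨fun h => h.ne', fun h => lt_of_le_of_ne (hl i) (Ne.symm h)⟩
  have hns : ∀ᵐ X ∂ν, (Xᴴ * (Dg lam : Matrix (Fin n) (Fin n) K) * X).det ≠ 0 := by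
    have hc : (Sᶜ).card + ℓ ≤ n := by
      rw [Finset.card_compl, Fintype.card_fin, hScard]
      have : H.rank ≤ n := by simpa using Matrix.rank_le_width H
      omega
    filter_upwards [ae_not_bad ν hinv hfull Sᶜ hc] with X hX h0
    refine hX ?_
    obtain ⟨c, hc, h⟩ := (quad_det_eq_zero_iff lam hl X).1 h0
    refine ⟨c, hc, fun a ha => h a ?_⟩
    have : a ∈ S := by simpa using ha
    exact ((hS a).1 this).ne'
  have hqℓ : q ≤ H.rank := by
    have : (q : ℝ) < ℓ := by linarith
    have : q < ℓ := by exact_mod_cast this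
    omega
  have hqr : (q : ℝ) < H.rank := by
    have : (q : ℝ) < ℓ := by linarith
    have : q < ℓ := by exact_mod_cast this
    exact_mod_cast (this.trans_le hrank)
  have hrn : H.rank ≤ n := by simpa using Matrix.rank_le_width H
  obtain ⟨D, hD, hDtop⟩ := exists_top lam q (hqℓ.trans hrn)
  have hDS : D ⊆ S := top_subset lam hl D S hS hDtop (by rw [hD, hScard]; exact hqℓ)
  have hmain := diag_bound ν hinv lam hl hns D S H.rank q hS hDS hScard hD hrank hq
  have hbt := best_trace H Hq (pinv n n Hq) V lam hl hV hHV hbest (hpinv n n Hq) D hD hDtop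
  have hFm : Measurable fun X : Matrix (Fin n) (Fin ℓ) K => ∑ i, lam i * (1 - xs lam i X) :=
    Finset.measurable_sum _ fun i _ => ((xs_meas lam i).const_sub 1).const_mul _
  have hns' : ∀ᵐ ω ∂μ, ((Vᴴ * M ω)ᴴ * (Dg lam : Matrix (Fin n) (Fin n) K) * (Vᴴ * M ω)).det ≠ 0 := by
    have h1 := (hinv Vᴴ hVs).quasiMeasurePreserving.ae hns
    exact ae_of_ae_map hMmeas.aemeasurable h1
  have hint : ∫ ω, RCLike.re (Matrix.trace
      (H - H * M ω * (pinv ℓ ℓ ((M ω)ᴴ * H * M ω) * ((M ω)ᴴ * H)))) ∂μ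
      = ∫ X, ∑ i, lam i * (1 - xs lam i X) ∂ν := by
    have e1 : ∫ X, ∑ i, lam i * (1 - xs lam i X) ∂ν
        = ∫ X, ∑ i, lam i * (1 - xs lam i (Vᴴ * X)) ∂ν :=
      (mp_integral (K := ℝ) (hinv Vᴴ hVs) _ hFm).symm
    have hFm2 : Measurable fun X : Matrix (Fin n) (Fin ℓ) K =>
        ∑ i, lam i * (1 - xs lam i (Vᴴ * X)) := hFm.comp (hmulmeas Vᴴ)
    rw [e1, hν, integral_map hMmeas.aemeasurable hFm2.aestronglyMeasurable]
    refine integral_congr_ae ?_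
    filter_upwards [hns'] with ω hω
    have hA : (M ω)ᴴ * H * M ω = (Vᴴ * M ω)ᴴ * (Dg lam : Matrix (Fin n) (Fin n) K) * (Vᴴ * M ω) := by
      conv_lhs => rw [hHV]
      simp only [Matrix.conjTranspose_mul, Matrix.conjTranspose_conjTranspose, Matrix.mul_assoc]
    rw [← hA] at hω
    have hp : pinv ℓ ℓ ((M ω)ᴴ * H * M ω) = ((M ω)ᴴ * H * M ω)⁻¹ := by
      have h1 := (hpinv ℓ ℓ ((M ω)ᴴ * H * M ω)).1
      generalize (M ω)ᴴ * H * M ω = A at *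
      have i1 : A⁻¹ * A = 1 := Matrix.nonsing_inv_mul _ hω.isUnit
      have i2 : A * A⁻¹ = 1 := Matrix.mul_nonsing_inv _ hω.isUnit
      calc pinv ℓ ℓ A = (A⁻¹ * A) * pinv ℓ ℓ A * (A * A⁻¹) := by
            rw [i1, i2, Matrix.one_mul, Matrix.mul_one]
        _ = A⁻¹ * (A * pinv ℓ ℓ A * A) * A⁻¹ := by simp only [Matrix.mul_assoc]
        _ = A⁻¹ := by rw [h1, i1, Matrix.one_mul]
    have h3 := nystrom_trace H V lam hV hHV (M ω)
    rw [← h3, hp]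
    simp only [Nf, Matrix.mul_assoc]
  rw [hint]
  refine hmain.trans ?_
  have hlr : (0 : ℝ) ≤ (H.rank : ℝ) - ℓ := by
    have : (ℓ : ℝ) ≤ H.rank := by exact_mod_cast hrank
    linarith
  have hL : (0 : ℝ) < (ℓ : ℝ) - q - alphaK K := by linarith
  refine mul_le_mul_of_nonneg_left (mul_le_mul_of_nonneg_left hbt ?_)
    (div_nonneg hlr (by linarith))
  have : (0 : ℝ) ≤ q / ((ℓ : ℝ) - q - alphaK K) := div_nonneg (Nat.cast_nonneg _) hL.le
  linarith
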